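/- arXiv:2509.01693 — 8 statements merged into one kernel-verified Lean document; each statement's English description precedes it below -/
import Mathlib

section
/- For every n : ℤ and r : R the following holds: if n ≥ 0, then C r * T n belongs to the extended Rees algebra T𝔞 if and only if r ∈ 𝔞^(n.toNat); and if n < 0, then C r * T n belongs to T𝔞 for every r ∈ R. (Equivalently, the degree-n graded component of the extended Rees algebra is 𝔞^n for n ≥ 0 and is all of R for n < 0.) -/
open LaurentPolynomial

/-- The Laurent polynomials whose `i`-th coefficient lies in `I ^ i.toNat` for every `i : ℤ`
(so that no condition is imposed in negative degrees). -/
def extendedReesAlgebra {R : Type*} [CommRing R] (I : Ideal R) : Subalgebra R R[T;T⁻¹] where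
  carrier := {f | ∀ i, f.coeff i ∈ I ^ i.toNat}
  mul_mem' {f g} hf hg i := by
    rw [AddMonoidAlgebra.coeff_mul]
    refine Ideal.sum_mem _ fun j _ ↦ Ideal.sum_mem _ fun k _ ↦ ?_
    beta_reduce
    split_ifs with h
    · have hjk : i.toNat ≤ j.toNat + k.toNat := by lia
      refine Ideal.pow_le_pow_right hjk ?_
      rw [pow_add]
      exact Ideal.mul_mem_mul (hf j) (hg k)
    · exact Ideal.zero_mem _
  add_mem' hf hg i := Ideal.add_mem _ (hf i) (hg i)
  algebraMap_mem' r i := by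
    rw [← C_eq_algebraMap, C_apply]
    split_ifs with h <;> simp [h]

theorem C_mul_T_mem_extendedReesAlgebra_iff {R : Type*} [CommRing R] {I : Ideal R} {n : ℤ}
    {r : R} : C r * T n ∈ extendedReesAlgebra I ↔ r ∈ I ^ n.toNat := by
  change (∀ i, (C r * T n : R[T;T⁻¹]).coeff i ∈ I ^ i.toNat) ↔ _
  simp_rw [← single_eq_C_mul_T, AddMonoidAlgebra.coeff_single, Finsupp.single_apply]
  refine ⟨fun h ↦ by simpa using h n, fun h i ↦ ?_⟩
  split_ifs with hi
  · exact hi ▸ h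
  · exact Ideal.zero_mem _

theorem C_mul_T_natCast_mem_of_mem_pow {R : Type*} [CommRing R] {I : Ideal R}
    {S : Subalgebra R R[T;T⁻¹]} (hS : ∀ a ∈ I, C a * T 1 ∈ S) {n : ℕ} {r : R}
    (hr : r ∈ I ^ n) : C r * T n ∈ S := by
  induction n generalizing r with
  | zero =>
    rw [Nat.cast_zero, T_zero, mul_one, C_eq_algebraMap]
    exact S.algebraMap_mem r
  | succ n ih =>
    rw [pow_succ] at hr
    induction hr using Submodule.mul_induction_on' with
    | mem_mul_mem a ha b hb =>
      have h : (C (a * b) * T ((n + 1 : ℕ) : ℤ) : R[T;T⁻¹]) = C a * T n * (C b * T 1) := by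
        rw [Nat.cast_succ, T_add, map_mul]
        ring
      rw [h]
      exact S.mul_mem (ih ha) (hS b hb)
    | add x _ y _ hx hy =>
      rw [map_add, add_mul]
      exact S.add_mem hx hy

/-- Let `R` be a commutative ring, `𝔞 ⊆ R` an ideal, and
`T𝔞 = R[𝔞t, t⁻¹] ⊆ R[t,t⁻¹]` the extended Rees algebra.  For `n ≥ 0`,
`C r * T n ∈ T𝔞 ↔ r ∈ 𝔞 ^ n.toNat`; for `n < 0`, `C r * T n ∈ T𝔞` for all `r`. -/
theorem extendedReesAlgebra_graded_components
    {R : Type*} [CommRing R] (𝔞 : Ideal R)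
    (T𝔞 : Subalgebra R (LaurentPolynomial R))
    (hT𝔞 : T𝔞 = Algebra.adjoin R
      ({x : LaurentPolynomial R | ∃ a ∈ 𝔞, C a * T 1 = x} ∪ {T (-1)}))
    (n : ℤ) (r : R) :
    (0 ≤ n → (C r * T n ∈ T𝔞 ↔ r ∈ 𝔞 ^ n.toNat)) ∧
    (n < 0 → C r * T n ∈ T𝔞) := by
  have hle : T𝔞 ≤ extendedReesAlgebra 𝔞 := by
    rw [hT𝔞, Algebra.adjoin_le_iff]
    rintro _ (⟨a, ha, rfl⟩ | rfl)
    · exact C_mul_T_mem_extendedReesAlgebra_iff.2 (by simpa using ha)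
    · rw [← one_mul (T (-1)), ← map_one C]
      exact C_mul_T_mem_extendedReesAlgebra_iff.2 (by simp)
  have hC : ∀ a ∈ 𝔞, C a * T 1 ∈ T𝔞 := fun a ha ↦
    hT𝔞 ▸ Algebra.subset_adjoin (Or.inl ⟨a, ha, rfl⟩)
  have hT : T (-1) ∈ T𝔞 := hT𝔞 ▸ Algebra.subset_adjoin (Or.inr rfl)
  refine ⟨fun hn ↦ ⟨fun h ↦ C_mul_T_mem_extendedReesAlgebra_iff.1 (hle h), fun h ↦ ?_⟩,
    fun hn ↦ ?_⟩
  · simpa [Int.toNat_of_nonneg hn] using C_mul_T_natCast_mem_of_mem_pow hC h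
  · have hn' : (n.natAbs : ℤ) * -1 = n := by lia
    rw [← hn', ← T_pow, C_eq_algebraMap]
    exact T𝔞.mul_mem (T𝔞.algebraMap_mem r) (T𝔞.pow_mem hT _)
end

section
/- For every Laurent polynomial f ∈ A there exists n : ℕ such that f * (T (-1))^n belongs to the extended Rees algebra T𝔞. Consequently, the localization of T𝔞 at the element T (-1) is all of A = R[t,t⁻¹]. -/
set_option synthInstance.maxHeartbeats 1000000
set_option maxHeartbeats 1000000

open LaurentPolynomial

namespace LaurentPolynomial

variable {R : Type*} [CommRing R] {S : Subalgebra R (LaurentPolynomial R)}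

/-- A subalgebra containing `t⁻¹` absorbs every Laurent polynomial after multiplication by a
large power of `t⁻¹`. -/
theorem exists_mul_T_neg_one_pow_mem (hS : T (-1) ∈ S) (f : LaurentPolynomial R) :
    ∃ n : ℕ, f * T (-1) ^ n ∈ S := by
  induction f using LaurentPolynomial.induction_on' with
  | add p q hp hq =>
    obtain ⟨m, hm⟩ := hp
    obtain ⟨n, hn⟩ := hq
    refine ⟨m + n, ?_⟩
    have h := S.add_mem (S.mul_mem hm (S.pow_mem hS n)) (S.mul_mem hn (S.pow_mem hS m))
    convert h using 1
    ring
  | C_mul_T k a =>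
    refine ⟨k.toNat, ?_⟩
    have hk : (T k * T (-1) ^ k.toNat : LaurentPolynomial R) = T (-1) ^ (-k).toNat := by
      rw [T_pow, T_pow, ← T_add]
      congr 1
      lia
    rw [mul_assoc, hk, C_eq_algebraMap]
    exact S.mul_mem (S.algebraMap_mem a) (S.pow_mem hS _)

/-- The ring of Laurent polynomials is the localization at `t⁻¹` of any subalgebra
containing `t⁻¹`. -/
theorem isLocalization_away_of_coe_eq_T_neg_one {y : S} (hy : (y : LaurentPolynomial R) = T (-1)) :
    IsLocalization.Away y (LaurentPolynomial R) := by
  have hy' : algebraMap S (LaurentPolynomial R) y = T (-1) := hy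
  refine IsLocalization.Away.mk y (hy' ▸ isUnit_T (-1)) (fun f ↦ ?_) fun a b h ↦
    ⟨0, congrArg _ (Subtype.ext h)⟩
  obtain ⟨n, hn⟩ := exists_mul_T_neg_one_pow_mem (hy ▸ y.2) f
  exact ⟨n, ⟨_, hn⟩, by rw [hy']; rfl⟩

end LaurentPolynomial

/-- Every Laurent polynomial `f ∈ R[t,t⁻¹]` lands in the extended Rees
algebra `T𝔞 = R[𝔞t, t⁻¹]` after multiplication by a sufficiently high power of `t⁻¹`;
consequently the localization of `T𝔞` at the element `t⁻¹` is all of `A = R[t,t⁻¹]`. -/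
theorem extendedReesAlgebra_localization_at_tinv
    {R : Type*} [CommRing R] (𝔞 : Ideal R)
    (T𝔞 : Subalgebra R (LaurentPolynomial R))
    (hT𝔞 : T𝔞 = Algebra.adjoin R
      ({x : LaurentPolynomial R | ∃ a ∈ 𝔞, C a * T 1 = x} ∪ {T (-1)})) :
    (∀ f : LaurentPolynomial R, ∃ n : ℕ, f * (T (-1)) ^ n ∈ T𝔞) ∧
    (∀ y : T𝔞, (y : LaurentPolynomial R) = T (-1) →
      IsLocalization.Away y (LaurentPolynomial R)) := by
  have hT : T (-1) ∈ T𝔞 := hT𝔞 ▸ Algebra.subset_adjoin (Or.inr rfl)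
  exact ⟨exists_mul_T_neg_one_pow_mem hT, fun _ hy ↦ isLocalization_away_of_coe_eq_T_neg_one hy⟩
end

section
/- Let J := 𝔪.map (algebraMap R A) be the extension of the maximal ideal 𝔪 to the Laurent polynomial ring A. Then for every k : ℕ there is an R-linear isomorphism H^k_J(A) ≅ ⊕_{i ∈ ℤ} H^k_𝔪(R), i.e. the k-th local cohomology of A along J, viewed as an R-module by restriction of scalars, is isomorphic to a direct sum of copies of H^k_𝔪(R) indexed by ℤ. -/
open LaurentPolynomial IsLocalRing

open CategoryTheory Limits

namespace CategoryTheory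

universe v₁ v₂ v₃ u₁ u₂ u₃

variable {C : Type u₁} [Category.{v₁} C] [Abelian C]
  {D : Type u₂} [Category.{v₂} D] [Abelian D]
  {E : Type u₃} [Category.{v₃} E] [Abelian E]

/-- Exact functors commute with the homology of complexes. -/
noncomputable def Functor.mapHomologicalComplexHomologyIso
    (G : D ⥤ E) [G.Additive] [G.PreservesHomology] {ι : Type*} (c : ComplexShape ι) (n : ι) :
    G.mapHomologicalComplex c ⋙ HomologicalComplex.homologyFunctor E c n ≅
      HomologicalComplex.homologyFunctor D c n ⋙ G :=
  NatIso.ofComponents (fun K => (K.sc n).mapHomologyIso G)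
    (fun f => ShortComplex.mapHomologyIso_hom_naturality
      ((HomologicalComplex.shortComplexFunctor D c n).map f) G)

lemma Functor.mapProjectiveResolution_π_f_zero (F : C ⥤ D) [F.Additive] [F.PreservesHomology]
    [F.PreservesProjectiveObjects] {X : C} (P : ProjectiveResolution X) :
    (F.mapProjectiveResolution P).π.f 0 = F.map (P.π.f 0) := by
  have e : ((HomologicalComplex.singleMapHomologicalComplex F (ComplexShape.down ℕ) 0).hom.app
      X).f 0 = 𝟙 (F.obj X) :=
    (HomologicalComplex.singleMapHomologicalComplex_hom_app_self F _ 0 X).trans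
      ((Category.comp_id (F.map (𝟙 X))).trans (F.map_id X))
  rw [F.mapProjectiveResolution_π, HomologicalComplex.comp_f, e]
  exact Category.comp_id _

variable [EnoughProjectives C]

/-- Left derived functors commute with precomposition by an exact functor preserving
projectives. -/
noncomputable def Functor.leftDerivedPrecompIso [EnoughProjectives D]
    (F : C ⥤ D) [F.Additive] [F.PreservesHomology] [F.PreservesProjectiveObjects]
    (G : D ⥤ E) [G.Additive] (n : ℕ) :
    (F ⋙ G).leftDerived n ≅ F ⋙ G.leftDerived n :=
  NatIso.ofComponents
    (fun X =>
      (ProjectiveResolution.of X).isoLeftDerivedObj (F ⋙ G) n ≪≫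
      (HomologicalComplex.homologyFunctor E _ n).mapIso
        ((mapHomologicalComplexCompIso (Iso.refl (F ⋙ G)) (ComplexShape.down ℕ)).symm.app
          (ProjectiveResolution.of X).complex) ≪≫
      ((F.mapProjectiveResolution (ProjectiveResolution.of X)).isoLeftDerivedObj G n).symm)
    (fun {X Y} f => by
      let P := ProjectiveResolution.of X
      let Q := ProjectiveResolution.of Y
      let φ := ProjectiveResolution.lift f P Q
      have hφ : φ.f 0 ≫ Q.π.f 0 = P.π.f 0 ≫ f := ProjectiveResolution.lift_commutes_zero f P Q
      have h₁ := ProjectiveResolution.isoLeftDerivedObj_hom_naturality f P Q φ hφ (F ⋙ G) n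
      have h₂ := ProjectiveResolution.isoLeftDerivedObj_inv_naturality (F.map f)
        (F.mapProjectiveResolution P) (F.mapProjectiveResolution Q)
        ((F.mapHomologicalComplex _).map φ) (by
          have h : F.map (φ.f 0) ≫ F.map (Q.π.f 0) = F.map (P.π.f 0) ≫ F.map f := by
            rw [← F.map_comp, hφ]
            exact F.map_comp _ _
          rw [F.mapProjectiveResolution_π_f_zero P, F.mapProjectiveResolution_π_f_zero Q]
          exact h) G n
      have h₃ := congrArg (HomologicalComplex.homologyFunctor E _ n).map
        ((mapHomologicalComplexCompIso (Iso.refl (F ⋙ G)) (ComplexShape.down ℕ)).inv.naturality φ)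
      simp only [Functor.map_comp] at h₃
      exact ((CommSq.mk h₁).vert_comp ((CommSq.mk h₃).vert_comp (CommSq.mk h₂.symm))).w)

/-- Left derived functors commute with postcomposition by an exact functor. -/
noncomputable def Functor.leftDerivedPostcompIso
    (F : C ⥤ D) [F.Additive]
    (G : D ⥤ E) [G.Additive] [G.PreservesHomology] (n : ℕ) :
    (F ⋙ G).leftDerived n ≅ F.leftDerived n ⋙ G :=
  NatIso.ofComponents
    (fun X =>
      (ProjectiveResolution.of X).isoLeftDerivedObj (F ⋙ G) n ≪≫
      (HomologicalComplex.homologyFunctor E _ n).mapIso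
        ((mapHomologicalComplexCompIso (Iso.refl (F ⋙ G)) (ComplexShape.down ℕ)).symm.app
          (ProjectiveResolution.of X).complex) ≪≫
      (G.mapHomologicalComplexHomologyIso _ n).app
        ((F.mapHomologicalComplex _).obj (ProjectiveResolution.of X).complex) ≪≫
      G.mapIso ((ProjectiveResolution.of X).isoLeftDerivedObj F n).symm)
    (fun {X Y} f => by
      let P := ProjectiveResolution.of X
      let Q := ProjectiveResolution.of Y
      let φ := ProjectiveResolution.lift f P Q
      have hφ : φ.f 0 ≫ Q.π.f 0 = P.π.f 0 ≫ f := ProjectiveResolution.lift_commutes_zero f P Q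
      have h₁ := ProjectiveResolution.isoLeftDerivedObj_hom_naturality f P Q φ hφ (F ⋙ G) n
      have h₂ := congrArg G.map
        (ProjectiveResolution.isoLeftDerivedObj_inv_naturality f P Q φ hφ F n)
      have h₃ := congrArg (HomologicalComplex.homologyFunctor E _ n).map
        ((mapHomologicalComplexCompIso (Iso.refl (F ⋙ G)) (ComplexShape.down ℕ)).inv.naturality φ)
      have h₄ := (G.mapHomologicalComplexHomologyIso (ComplexShape.down ℕ) n).hom.naturality
        ((F.mapHomologicalComplex _).map φ)
      simp only [Functor.map_comp] at h₂ h₃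
      simp only [Iso.trans_hom, Iso.symm_hom, Category.assoc, Functor.mapIso_hom, Iso.app_hom]
      rw [reassoc_of% h₁]
      simp only [Functor.comp_map] at h₂ h₃ h₄ ⊢
      rw [reassoc_of% h₃, reassoc_of% h₄, h₂])

/-- A natural isomorphism of additive functors induces one on left derived functors. -/
noncomputable def NatIso.leftDerived {F G : C ⥤ D} [F.Additive] [G.Additive] (α : F ≅ G) (n : ℕ) :
    F.leftDerived n ≅ G.leftDerived n where
  hom := NatTrans.leftDerived α.hom n
  inv := NatTrans.leftDerived α.inv n
  hom_inv_id := by rw [← NatTrans.leftDerived_comp, α.hom_inv_id, NatTrans.leftDerived_id]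
  inv_hom_id := by rw [← NatTrans.leftDerived_comp, α.inv_hom_id, NatTrans.leftDerived_id]

end CategoryTheory

namespace FGModuleCat

variable {R : Type} [CommRing R] [IsNoetherianRing R]

instance projective_of_free (n : ℕ) : Projective (FGModuleCat.of R (Fin n → R)) where
  factors {E X} f e _ := by
    have he : Epi ((forget₂ (FGModuleCat.{0} R) (ModuleCat.{0} R)).map e) := inferInstance
    obtain ⟨g, hg⟩ := Module.projective_lifting_property e.hom.hom f.hom.hom
      ((ModuleCat.epi_iff_surjective _).mp he)
    exact ⟨FGModuleCat.ofHom g, FGModuleCat.hom_ext hg⟩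

lemma exists_epi_of_free (X : FGModuleCat.{0} R) :
    ∃ (n : ℕ) (f : FGModuleCat.of R (Fin n → R) ⟶ X), Epi f := by
  obtain ⟨n, f, hf⟩ := Module.Finite.exists_fin' R X
  refine ⟨n, FGModuleCat.ofHom f, ?_⟩
  have : Epi ((forget₂ (FGModuleCat.{0} R) (ModuleCat.{0} R)).map
      (FGModuleCat.ofHom f : FGModuleCat.of R (Fin n → R) ⟶ X)) :=
    (ModuleCat.epi_iff_surjective _).mpr hf
  exact Functor.epi_of_epi_map (forget₂ (FGModuleCat.{0} R) (ModuleCat.{0} R)) this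

instance enoughProjectives : EnoughProjectives (FGModuleCat.{0} R) where
  presentation X := by
    obtain ⟨n, f, hf⟩ := exists_epi_of_free X
    exact ⟨{ p := _, projective := projective_of_free n, f := f, epi := hf }⟩

instance preservesProjectiveObjects_forget₂ :
    (forget₂ (FGModuleCat.{0} R) (ModuleCat.{0} R)).PreservesProjectiveObjects where
  projective_obj {X} hX := by
    obtain ⟨n, f, hf⟩ := exists_epi_of_free X
    have : Projective (ModuleCat.of R (Fin n → R)) :=
      (IsProjective.iff_projective (Fin n → R)).mp inferInstance
    have r : Retract X (FGModuleCat.of R (Fin n → R)) :=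
      { i := Projective.factorThru (𝟙 X) f, r := f }
    exact Retract.projective (Y := ModuleCat.of R (Fin n → R))
      (r.map (forget₂ (FGModuleCat.{0} R) (ModuleCat.{0} R)))

end FGModuleCat

namespace ModuleCat

variable {R S : Type} [CommRing R] [CommRing S] (f : R →+* S)

instance extendScalars_additive : (extendScalars.{0, 0, 0} f).Additive :=
  (extendRestrictScalarsAdj f).left_adjoint_additive

instance extendScalars_preservesProjectiveObjects :
    (extendScalars.{0, 0, 0} f).PreservesProjectiveObjects :=
  Functor.preservesProjectiveObjects_of_adjunction_of_preservesEpimorphisms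
    (extendRestrictScalarsAdj f)

variable {f}
lemma preservesHomology_forget₂_comp_extendScalars [IsNoetherianRing R] (hf : f.Flat) :
    (forget₂ (FGModuleCat.{0} R) (ModuleCat.{0} R) ⋙
      extendScalars.{0, 0, 0} f).PreservesHomology :=
  have := preservesFiniteLimits_extendScalars_of_flat hf
  have : PreservesFiniteColimits (extendScalars.{0, 0, 0} f) :=
    PreservesColimits.preservesFiniteColimits _
  have : PreservesFiniteLimits (forget₂ (FGModuleCat.{0} R) (ModuleCat.{0} R) ⋙
      extendScalars.{0, 0, 0} f) := comp_preservesFiniteLimits _ _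
  have : PreservesFiniteColimits (forget₂ (FGModuleCat.{0} R) (ModuleCat.{0} R) ⋙
      extendScalars.{0, 0, 0} f) := comp_preservesFiniteColimits _ _
  inferInstance

lemma preservesHomology_op_extendScalars (hf : f.Flat) :
    (extendScalars.{0, 0, 0} f).op.PreservesHomology :=
  have := preservesFiniteLimits_extendScalars_of_flat hf
  have : PreservesFiniteColimits (extendScalars.{0, 0, 0} f) :=
    PreservesColimits.preservesFiniteColimits _
  have : PreservesFiniteLimits (extendScalars.{0, 0, 0} f).op := preservesFiniteLimits_op _
  have : PreservesFiniteColimits (extendScalars.{0, 0, 0} f).op := preservesFiniteColimits_op _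
  inferInstance

end ModuleCat

open TensorProduct in
/-- Over a flat algebra, forming the dual of a finitely presented module commutes with base
change. -/
noncomputable def Module.FinitePresentation.dualBaseChangeEquiv (R S M : Type) [CommRing R]
    [CommRing S] [Algebra R S] [AddCommGroup M] [Module R M] [Module.Flat R S]
    [Module.FinitePresentation R M] :
    S ⊗[R] (M →ₗ[R] R) ≃ₗ[S] (S ⊗[R] M →ₗ[S] S) :=
  (Module.FinitePresentation.isBaseChange_map R M R S).equiv ≪≫ₗ
    LinearEquiv.congrRight (AlgebraTensorModule.rid R S S)

open TensorProduct in
lemma Module.FinitePresentation.dualBaseChangeEquiv_tmul_tmul (R S M : Type) [CommRing R]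
    [CommRing S] [Algebra R S] [AddCommGroup M] [Module R M] [Module.Flat R S]
    [Module.FinitePresentation R M] (s s' : S) (φ : M →ₗ[R] R) (m : M) :
    dualBaseChangeEquiv R S M (s ⊗ₜ φ) (s' ⊗ₜ m) = s * (φ m • s') := by
  rw [dualBaseChangeEquiv, LinearEquiv.trans_apply, IsBaseChange.equiv_tmul, map_smul]
  change s • (φ m • s') = _
  rw [smul_eq_mul]

namespace ModuleCat

variable {R S : Type} [CommRing R] [CommRing S] {f : R →+* S}

/-- The dual of a module, as a functor. -/
noncomputable abbrev dualFunctor (R : Type) [CommRing R] : (ModuleCat.{0} R)ᵒᵖ ⥤ ModuleCat.{0} R :=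
  (linearYoneda R (ModuleCat.{0} R)).obj (of R R)

/-- Extension of scalars along a flat map commutes with the dual. -/
noncomputable def extendScalarsDualIso (hf : f.Flat) (M : ModuleCat.{0} R)
    [Module.FinitePresentation R M] :
    (extendScalars.{0, 0, 0} f).obj ((dualFunctor R).obj (.op M)) ≅
      (dualFunctor S).obj (.op ((extendScalars.{0, 0, 0} f).obj M)) :=
  letI := f.toAlgebra
  letI : Module.Flat R S := hf
  letI e₁ : TensorProduct R S (M ⟶ of R R) ≃ₗ[S] TensorProduct R S (M →ₗ[R] R) :=
    (homLinearEquiv (S := R) (M := M) (N := of R R)).baseChange R S _ _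
  letI e₂ : (TensorProduct R S M →ₗ[S] S) ≃ₗ[S]
      (of S (TensorProduct R S M) ⟶ of S S) :=
    (homLinearEquiv (S := S) (M := of S (TensorProduct R S M)) (N := of S S)).symm
  (e₁ ≪≫ₗ (Module.FinitePresentation.dualBaseChangeEquiv R S M) ≪≫ₗ e₂).toModuleIso

open ChangeOfRings in
lemma extendScalarsDualIso_hom_apply (hf : f.Flat) (M : ModuleCat.{0} R)
    [Module.FinitePresentation R M] (φ : M ⟶ of R R) (m : M) :
    ((extendScalarsDualIso hf M).hom ((1 : S) ⊗ₜ[R,f] φ)).hom ((1 : S) ⊗ₜ[R,f] m) =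
      f (φ m) := by
  let := f.toAlgebra
  have : Module.Flat R S := hf
  refine (Module.FinitePresentation.dualBaseChangeEquiv_tmul_tmul R S M 1 1 φ.hom m).trans ?_
  rw [one_mul, Algebra.smul_def, mul_one]
  rfl

lemma extendScalarsDualIso_hom_naturality (hf : f.Flat) {M N : ModuleCat.{0} R}
    [Module.FinitePresentation R M] [Module.FinitePresentation R N] (g : M ⟶ N) :
    (extendScalars.{0, 0, 0} f).map ((dualFunctor R).map g.op) ≫
        (extendScalarsDualIso hf M).hom =
      (extendScalarsDualIso hf N).hom ≫
        (dualFunctor S).map ((extendScalars.{0, 0, 0} f).map g).op := by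
  refine ExtendScalars.hom_ext fun φ => ?_
  refine ExtendScalars.hom_ext fun m => ?_
  exact (extendScalarsDualIso_hom_apply hf M (g ≫ φ) m).trans
    (extendScalarsDualIso_hom_apply hf N φ (g m)).symm

/-- On finitely generated modules over a Noetherian ring, flat extension of scalars commutes with
the dual. -/
noncomputable def extendScalarsDualNatIso [IsNoetherianRing R] (hf : f.Flat) :
    (forget₂ (FGModuleCat.{0} R) (ModuleCat.{0} R) ⋙ extendScalars.{0, 0, 0} f) ⋙
        (dualFunctor S).rightOp ≅
      (forget₂ (FGModuleCat.{0} R) (ModuleCat.{0} R) ⋙ (dualFunctor R).rightOp) ⋙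
        (extendScalars.{0, 0, 0} f).op :=
  haveI (M : FGModuleCat.{0} R) : Module.FinitePresentation R
      ((forget₂ (FGModuleCat.{0} R) (ModuleCat.{0} R)).obj M) :=
    Module.finitePresentation_of_finite R M
  NatIso.ofComponents
    (fun M => (extendScalarsDualIso hf ((forget₂ (FGModuleCat.{0} R) (ModuleCat.{0} R)).obj M)).op)
    (fun {M N} g => by
      have h := extendScalarsDualIso_hom_naturality hf
        ((forget₂ (FGModuleCat.{0} R) (ModuleCat.{0} R)).map g)
      exact congrArg Quiver.Hom.op h.symm)

/-- Flat base change for `Ext(-, R)` on finitely generated modules over a Noetherian ring. -/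
noncomputable def leftDerivedDualFlatBaseChangeIso [IsNoetherianRing R] (hf : f.Flat) (n : ℕ) :
    (forget₂ (FGModuleCat.{0} R) (ModuleCat.{0} R) ⋙ extendScalars.{0, 0, 0} f) ⋙
        (dualFunctor S).rightOp.leftDerived n ≅
      (forget₂ (FGModuleCat.{0} R) (ModuleCat.{0} R) ⋙ (dualFunctor R).rightOp.leftDerived n) ⋙
        (extendScalars.{0, 0, 0} f).op :=
  haveI := preservesHomology_forget₂_comp_extendScalars hf
  haveI := preservesHomology_op_extendScalars hf
  (Functor.leftDerivedPrecompIso _ _ n).symm ≪≫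
    NatIso.leftDerived (extendScalarsDualNatIso hf) n ≪≫
    Functor.leftDerivedPostcompIso _ _ n ≪≫
    Functor.isoWhiskerRight (Functor.leftDerivedPrecompIso _ _ n) _

end ModuleCat

namespace localCohomology

variable {R S : Type} [CommRing R] [CommRing S] {f : R →+* S} {D : Type} [SmallCategory D]

/-- The quotients of `R` by a system of ideals, as finitely generated modules. -/
noncomputable def fgRingModIdeals (I : D ⥤ Ideal R) : D ⥤ FGModuleCat.{0} R :=
  ObjectProperty.lift _ (ringModIdeals I)
    (fun d => (inferInstance : Module.Finite R (R ⧸ I.obj d)))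

/-- Extension of scalars of `R ⧸ I` is the quotient by the extended ideal. -/
noncomputable def extendScalarsQuotientIso (I : Ideal R) (J : Ideal S) (h : J = I.map f) :
    (ModuleCat.extendScalars.{0, 0, 0} f).obj (ModuleCat.of R (R ⧸ I)) ≅ ModuleCat.of S (S ⧸ J) :=
  letI := f.toAlgebra
  letI e : TensorProduct R S (R ⧸ I) ≃ₗ[S] (S ⧸ J) :=
    (Algebra.TensorProduct.quotIdealMapEquivTensorQuot S I).toLinearEquiv.symm ≪≫ₗ
      Submodule.quotEquivOfEq _ _ h.symm
  e.toModuleIso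

open ChangeOfRings in
lemma extendScalarsQuotientIso_hom_apply (I : Ideal R) (J : Ideal S) (h : J = I.map f) (r : R) :
    (extendScalarsQuotientIso I J h).hom ((1 : S) ⊗ₜ[R,f] (Ideal.Quotient.mk I r)) =
      Ideal.Quotient.mk J (f r) := by
  let := f.toAlgebra
  subst h
  have h₁ := Algebra.TensorProduct.quotIdealMapEquivTensorQuot_symm_tmul S I 1 r
  rw [Algebra.smul_def, mul_one] at h₁
  exact congrArg (Submodule.quotEquivOfEq _ _ rfl) h₁

/-- Extension of scalars takes the system of quotients by a system of ideals to the system of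
quotients by the extended ideals. -/
noncomputable def fgRingModIdealsExtendScalarsIso (I : D ⥤ Ideal R) (J : D ⥤ Ideal S)
    (h : ∀ d, J.obj d = (I.obj d).map f) :
    fgRingModIdeals I ⋙ forget₂ (FGModuleCat.{0} R) (ModuleCat.{0} R) ⋙
      ModuleCat.extendScalars.{0, 0, 0} f ≅ ringModIdeals J :=
  NatIso.ofComponents (fun d => extendScalarsQuotientIso (I.obj d) (J.obj d) (h d))
    (fun {d d'} w => by
      refine ModuleCat.ExtendScalars.hom_ext fun m => ?_
      obtain ⟨r, rfl⟩ := Ideal.Quotient.mk_surjective m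
      have h₁ := extendScalarsQuotientIso_hom_apply (I.obj d) (J.obj d) (h d) r
      have h₂ := extendScalarsQuotientIso_hom_apply (I.obj d') (J.obj d') (h d') r
      exact h₂.trans (congrArg ((ringModIdeals J).map w) h₁).symm)

/-- A natural isomorphism of functors to an opposite category, unopped. -/
def leftOpIso {C C' : Type*} [Category C] [Category C'] {F G : C ⥤ C'ᵒᵖ} (e : F ≅ G) :
    G.leftOp ≅ F.leftOp where
  hom := NatTrans.leftOp e.hom
  inv := NatTrans.leftOp e.inv
  hom_inv_id := by rw [← NatTrans.leftOp_comp, e.inv_hom_id, NatTrans.leftOp_id]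
  inv_hom_id := by rw [← NatTrans.leftOp_comp, e.hom_inv_id, NatTrans.leftOp_id]

/-- Flat base change for the diagrams defining local cohomology of the ring itself. -/
noncomputable def diagramEvaluationFlatBaseChangeIso [IsNoetherianRing R] (hf : f.Flat)
    (I : D ⥤ Ideal R) (J : D ⥤ Ideal S) (h : ∀ d, J.obj d = (I.obj d).map f) (k : ℕ) :
    diagram J k ⋙ (evaluation _ _).obj (ModuleCat.of S S) ≅
      (diagram I k ⋙ (evaluation _ _).obj (ModuleCat.of R R)) ⋙
        ModuleCat.extendScalars.{0, 0, 0} f :=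
  leftOpIso (F := ((fgRingModIdeals I ⋙ forget₂ (FGModuleCat.{0} R) (ModuleCat.{0} R)) ⋙
      (ModuleCat.dualFunctor R).rightOp.leftDerived k) ⋙
        (ModuleCat.extendScalars.{0, 0, 0} f).op)
    (G := ringModIdeals J ⋙ (ModuleCat.dualFunctor S).rightOp.leftDerived k)
    (Functor.isoWhiskerLeft (fgRingModIdeals I)
      (ModuleCat.leftDerivedDualFlatBaseChangeIso hf k).symm ≪≫
      Functor.isoWhiskerRight (fgRingModIdealsExtendScalarsIso I J h)
        ((ModuleCat.dualFunctor S).rightOp.leftDerived k))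

/-- Flat base change for local cohomology of the ring itself along a system of ideals. -/
noncomputable def ofDiagramFlatBaseChangeIso [IsNoetherianRing R] (hf : f.Flat)
    (I : D ⥤ Ideal R) (J : D ⥤ Ideal S) (h : ∀ d, J.obj d = (I.obj d).map f) (k : ℕ) :
    (ofDiagram.{0, 0} J k).obj (ModuleCat.of S S) ≅
      (ModuleCat.extendScalars.{0, 0, 0} f).obj
        ((ofDiagram.{0, 0} I k).obj (ModuleCat.of R R)) :=
  colimitObjIsoColimitCompEvaluation (diagram J k) _ ≪≫
    HasColimit.isoOfNatIso (diagramEvaluationFlatBaseChangeIso hf I J h k) ≪≫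
    (preservesColimitIso (ModuleCat.extendScalars.{0, 0, 0} f) _).symm ≪≫
    (ModuleCat.extendScalars.{0, 0, 0} f).mapIso
      (colimitObjIsoColimitCompEvaluation (diagram I k) _).symm

/-- Flat base change for local cohomology of a Noetherian ring. -/
noncomputable def flatBaseChangeIso [IsNoetherianRing R] (hf : f.Flat)
    (I : Ideal R) (k : ℕ) :
    (localCohomology (I.map f) k).obj (ModuleCat.of S S) ≅
      (ModuleCat.extendScalars.{0, 0, 0} f).obj
        ((localCohomology I k).obj (ModuleCat.of R R)) :=
  ofDiagramFlatBaseChangeIso hf (idealPowersDiagram I) (idealPowersDiagram (I.map f))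
    (fun _ => (Ideal.map_pow f I _).symm) k

end localCohomology

lemma ModuleCat.exists_extendScalars_addEquiv_finsupp {R S : Type} [CommRing R] [CommRing S]
    (f : R →+* S) {ι : Type} (b : S ≃+ (ι →₀ R)) (hb : ∀ r s, b (f r * s) = r • b s)
    (M : ModuleCat.{0} R) :
    ∃ e : (ModuleCat.extendScalars.{0, 0, 0} f).obj M ≃+ (ι →₀ M),
      ∀ (r : R) x, e (f r • x) = r • e x := by
  classical
  let := f.toAlgebra
  let b' : S ≃ₗ[R] (ι →₀ R) := b.toLinearEquiv fun r s => by rw [Algebra.smul_def]; exact hb r s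
  let e : TensorProduct R S M ≃ₗ[R] (ι →₀ M) :=
    TensorProduct.congr b' (LinearEquiv.refl R M) ≪≫ₗ TensorProduct.finsuppScalarLeft R M ι
  have he (r : R) (x : TensorProduct R S M) : e (f r • x) = r • e x := by
    rw [← map_smul]
    exact congrArg e (algebraMap_smul S r x)
  exact ⟨e.toAddEquiv, he⟩

/-- Let `(R,𝔪)` be a Noetherian local ring, `A = R[t,t⁻¹]` the Laurent
polynomial ring, and `J = 𝔪·A`.  Then for every `k`, as `R`-modules (by restriction of
scalars), `H^k_J(A) ≅ ⊕_{i ∈ ℤ} H^k_𝔪(R)`. -/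
theorem localCohomology_laurent_extension_of_maximalIdeal
    {R : Type} [CommRing R] [IsNoetherianRing R] [IsLocalRing R]
    (J : Ideal (LaurentPolynomial R))
    (hJ : J = (maximalIdeal R).map (algebraMap R (LaurentPolynomial R)))
    (k : ℕ) :
    Nonempty
      ((RestrictScalars R (LaurentPolynomial R)
          ((localCohomology J k).obj
            (ModuleCat.of (LaurentPolynomial R) (LaurentPolynomial R)))) ≃ₗ[R]
        (DirectSum ℤ fun _ : ℤ =>
          ((localCohomology (maximalIdeal R) k).obj (ModuleCat.of R R)))) := by
  subst hJ
  have hf : (algebraMap R (LaurentPolynomial R)).Flat :=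
    RingHom.flat_algebraMap_iff.mpr inferInstance
  let ε := (localCohomology.flatBaseChangeIso hf (maximalIdeal R) k).toLinearEquiv
  obtain ⟨e, he⟩ := ModuleCat.exists_extendScalars_addEquiv_finsupp
    (algebraMap R (LaurentPolynomial R))
    (AddMonoidAlgebra.coeffLinearEquiv R : LaurentPolynomial R ≃ₗ[R] (ℤ →₀ R)).toAddEquiv
    (fun r s => by
      rw [← Algebra.smul_def]
      exact map_smul (AddMonoidAlgebra.coeffLinearEquiv R) r s)
    ((localCohomology (maximalIdeal R) k).obj (ModuleCat.of R R))
  let e' : RestrictScalars R (LaurentPolynomial R)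
      ((localCohomology ((maximalIdeal R).map (algebraMap R (LaurentPolynomial R))) k).obj
        (ModuleCat.of (LaurentPolynomial R) (LaurentPolynomial R))) ≃ₗ[R]
      (ℤ →₀ (localCohomology (maximalIdeal R) k).obj (ModuleCat.of R R)) :=
    ((RestrictScalars.addEquiv R (LaurentPolynomial R) _).trans
      (ε.toAddEquiv.trans e)).toLinearEquiv fun r x => by
        have h := he r (ε (RestrictScalars.addEquiv R (LaurentPolynomial R) _ x))
        rw [← map_smul] at h
        exact h
  classical
  exact ⟨e' ≪≫ₗ finsuppLEquivDirectSum R _ ℤ⟩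
end

section
/- Let d : ℕ be such that ringKrullDim R = d, and let J := 𝔪.map (algebraMap R A) be the extension of the maximal ideal 𝔪 to the Laurent polynomial ring A. Then H^{d+1}_J(A) = 0, i.e. the (d+1)-st local cohomology of A along J is the trivial module. -/
/-- The elements of `M` that are killed by a power of each element of `s`. -/
def IsPowerTorsion {A M : Type*} [CommRing A] [AddCommGroup M] [Module A M]
    (s : Set A) (m : M) : Prop :=
  ∀ x ∈ s, ∃ n : ℕ, x ^ n • m = 0

section Torsion

variable {A M : Type*} [CommRing A] [AddCommGroup M] [Module A M]

lemma IsPowerTorsion.sub {s : Set A} {m m' : M} (h : IsPowerTorsion s m)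
    (h' : IsPowerTorsion s m') : IsPowerTorsion s (m - m') := by
  intro x hx
  obtain ⟨n, hn⟩ := h x hx
  obtain ⟨n', hn'⟩ := h' x hx
  refine ⟨n + n', ?_⟩
  rw [smul_sub, pow_add, mul_smul _ _ m', hn', mul_comm, mul_smul, hn]
  simp

lemma IsPowerTorsion.map {N : Type*} [AddCommGroup N] [Module A N] {s : Set A} {m : M}
    (h : IsPowerTorsion s m) (f : M →ₗ[A] N) : IsPowerTorsion s (f m) := by
  intro x hx
  obtain ⟨n, hn⟩ := h x hx
  exact ⟨n, by rw [← map_smul, hn, map_zero]⟩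

lemma IsPowerTorsion.smul {s : Set A} {m : M} (h : IsPowerTorsion s m) (a : A) :
    IsPowerTorsion s (a • m) :=
  h.map (LinearMap.lsmul A M a)

lemma isPowerTorsion_insert {s : Set A} {x : A} {m : M} :
    IsPowerTorsion (insert x s) m ↔ (∃ n : ℕ, x ^ n • m = 0) ∧ IsPowerTorsion s m := by
  simp [IsPowerTorsion]

/-- If `J` is contained in the radical of the ideal generated by `s`, then an element which is
power-torsion for `s` is killed by a power of `J`. -/
lemma IsPowerTorsion.exists_pow_smul_eq_zero [IsNoetherianRing A] {s : Set A} {J : Ideal A}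
    (hJ : J ≤ (Ideal.span s).radical) {m : M} (h : IsPowerTorsion s m) :
    ∃ n : ℕ, ∀ a ∈ J ^ n, a • m = 0 := by
  have hs : Ideal.span s ≤ (Ideal.torsionOf A M m).radical := by
    rw [Ideal.span_le]
    intro x hx
    obtain ⟨n, hn⟩ := h x hx
    exact ⟨n, by simpa using hn⟩
  obtain ⟨n, hn⟩ := Ideal.exists_pow_le_of_le_radical_of_fg
    (hJ.trans (Ideal.radical_le_radical_iff.2 hs)) (IsNoetherian.noetherian J)
  exact ⟨n, fun a ha ↦ by simpa using hn ha⟩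

/-- Over a Noetherian ring, every element `w` of an injective module is a multiple of `x ^ n` up to
an element killed by a power of `x`, and the quotient can be chosen as the image of `w` under a
linear map from `A w`. -/
lemma Module.Injective.exists_pow_smul_sub_eq_zero [IsNoetherianRing A] [Module.Injective A M]
    (w : M) (x : A) (n : ℕ) :
    ∃ w' : M, (∀ a : A, a • w = 0 → a • w' = 0) ∧ ∃ N : ℕ, x ^ N • (w - x ^ n • w') = 0 := by
  let S : Submodule A M := Submodule.span A {w}
  let w₀ : S := ⟨w, Submodule.mem_span_singleton_self w⟩
  let μ : Module.End A S := LinearMap.lsmul A S x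
  have hμ (k : ℕ) (v : S) : (μ ^ k) v = x ^ k • v := by
    induction k with
    | zero => simp
    | succ k ih => rw [pow_succ', Module.End.mul_apply, ih, pow_succ', mul_smul]; rfl
  obtain ⟨N, hN⟩ := monotone_stabilizes_iff_noetherian.2 (inferInstance : IsNoetherian A S)
    μ.iterateKer
  let f : S →ₗ[A] S := μ ^ (N + n)
  let g : S →ₗ[A] M := S.subtype ∘ₗ (μ ^ N)
  have hfg : f.ker ≤ g.ker := by
    have h : (μ ^ N).ker = (μ ^ (N + n)).ker := hN (N + n) (by lia)
    intro v hv
    have : v ∈ (μ ^ N).ker := h ▸ hv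
    simpa [g] using congrArg S.subtype this
  obtain ⟨h, hh⟩ := Module.Injective.out (f.ker.liftQ f le_rfl)
    (by rw [← LinearMap.ker_eq_bot]; exact Submodule.ker_liftQ_eq_bot _ _ _ le_rfl)
    (f.ker.liftQ g hfg)
  refine ⟨h w₀, fun a ha ↦ ?_, N, ?_⟩
  · rw [← map_smul, show a • w₀ = 0 from Subtype.ext ha, map_zero]
  · have := hh (Submodule.Quotient.mk w₀)
    simp only [Submodule.liftQ_apply, f, g, hμ, LinearMap.comp_apply, map_smul] at this
    rw [smul_sub, ← mul_smul, ← pow_add, this]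
    simp [w₀]

/-- The complex of `s`-power-torsion elements of an injective resolution is exact in degrees greater
than the number of elements of `s`. -/
theorem exists_isPowerTorsion_of_exact [IsNoetherianRing A] {E : ℕ → Type*}
    [∀ n, AddCommGroup (E n)] [∀ n, Module A (E n)] [∀ n, Module.Injective A (E n)]
    (δ : ∀ n, E n →ₗ[A] E (n + 1)) (hδ : ∀ n, Function.Exact (δ n) (δ (n + 1)))
    (s : Finset A) (i : ℕ) (hi : s.card ≤ i) (z : E (i + 1)) (hz : IsPowerTorsion (s : Set A) z)
    (hδz : δ (i + 1) z = 0) :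
    ∃ y : E i, IsPowerTorsion (s : Set A) y ∧ δ i y = z := by
  classical
  induction s using Finset.induction_on generalizing i with
  | empty =>
    obtain ⟨y, hy⟩ := (hδ i z).1 hδz
    exact ⟨y, by simp [IsPowerTorsion], hy⟩
  | insert x s hx ih =>
    rw [Finset.card_insert_of_notMem hx] at hi
    rw [Finset.coe_insert, isPowerTorsion_insert] at hz
    obtain ⟨⟨n, hn⟩, hz⟩ := hz
    obtain ⟨y, hys, hyz⟩ := ih i (by lia) z hz hδz
    obtain _ | i := i
    · lia
    obtain ⟨w, hws, hwy⟩ := ih i (by lia) (x ^ n • y) (hys.smul _) (by rw [map_smul, hyz, hn])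
    obtain ⟨w', hw', N, hN⟩ := Module.Injective.exists_pow_smul_sub_eq_zero w x n
    refine ⟨y - δ i w', ?_, ?_⟩
    · rw [Finset.coe_insert, isPowerTorsion_insert]
      refine ⟨⟨N + n, ?_⟩, hys.sub (IsPowerTorsion.map (fun a ha ↦ ?_) _)⟩
      · rw [pow_add, mul_smul, smul_sub, ← hwy, ← map_smul, ← map_sub, ← map_smul, hN, map_zero]
      · exact (hws a ha).imp fun k hk ↦ hw' _ hk
    · rw [map_sub, hyz, (hδ i).apply_apply_eq_zero, sub_zero]

end Torsion

open IsLocalRing in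
/-- A Noetherian local ring has a system of parameters. -/
lemma IsLocalRing.exists_finset_maximalIdeal_le_radical {R : Type*} [CommRing R]
    [IsNoetherianRing R] [IsLocalRing R] (d : ℕ) (hd : ringKrullDim R = d) :
    ∃ s : Finset R, s.card = d ∧ (s : Set R) ⊆ maximalIdeal R ∧
      maximalIdeal R ≤ (Ideal.span (s : Set R)).radical := by
  obtain ⟨s, hs, hcard⟩ := (maximalIdeal R).exists_finset_card_eq_height_of_isNoetherianRing
  have h := IsLocalRing.maximalIdeal_height_eq_ringKrullDim (R := R)
  rw [← hcard, hd] at h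
  refine ⟨s, by exact_mod_cast h, Ideal.span_le.1 hs.1.2, ?_⟩
  rw [Ideal.radical_eq_sInf]
  refine le_sInf fun p hp ↦ hs.2 ⟨hp.2, hp.1⟩ ?_
  have := hp.2
  exact le_maximalIdeal this.ne_top

section LocalCohomology

open CategoryTheory Limits Opposite HomologicalComplex

universe v u

section DerivedFunctors

variable {R : Type*} [Ring R] {C : Type u} [Category.{v} C] [Abelian C] [Linear R C]
  [EnoughProjectives C]

/-- The map of cochain complexes `Hom(P, Y) ⟶ Hom(P', Y)` induced by a chain map `P' ⟶ P`. -/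
abbrev ChainComplex.linearYonedaMap (R : Type*) [Ring R] [Linear R C] {P' P : ChainComplex C ℕ}
    (φ : P' ⟶ P) (Y : C) : P.linearYonedaObj R Y ⟶ P'.linearYonedaObj R Y :=
  (HomologicalComplex.unopFunctor _ _).map
    ((((linearYoneda R C).obj Y).rightOp.mapHomologicalComplex _).map φ).op

lemma CategoryTheory.ProjectiveResolution.isoExt_hom_naturality {X' X : C}
    (P' : ProjectiveResolution X') (P : ProjectiveResolution X) {f : X' ⟶ X} (φ : P'.Hom P f)
    (n : ℕ) (Y : C) :
    ((Ext R C n).map f.op).app Y ≫ (P'.isoExt (R := R) n Y).hom =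
      (P.isoExt (R := R) n Y).hom ≫
        homologyMap (ChainComplex.linearYonedaMap R φ.hom Y) n := by
  have h₁ := congrArg Quiver.Hom.unop (ProjectiveResolution.isoLeftDerivedObj_hom_naturality f P' P
    φ.hom (φ.hom_f_zero_comp_π_f_zero.trans (by rw [ChainComplex.single₀_map_f_zero]; rfl))
    ((linearYoneda R C).obj Y).rightOp n)
  have h₂ := congrArg Quiver.Hom.unop
    (homologyOp_hom_naturality (ChainComplex.linearYonedaMap R φ.hom Y) n)
  rw [← cancel_epi (P.isoExt (R := R) n Y).inv, Iso.inv_hom_id_assoc, ← Category.assoc,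
    ← Iso.eq_comp_inv]
  simp only [ProjectiveResolution.isoExt, homologyUnop]
  refine (Category.assoc _ _ _).trans ((congrArg _ h₁).trans ?_)
  refine (Category.assoc _ _ _).symm.trans (Eq.trans ?_ (Category.assoc _ _ _))
  exact congrArg (· ≫ (P'.isoLeftDerivedObj ((linearYoneda R C).obj Y).rightOp n).hom.unop) h₂

/-- Each element of the derived-functor `Ext` in positive degree has a counterpart in `Abelian.Ext`
such that pulling back the latter to zero forces the former to pull back to zero. -/
lemma exists_abelianExt_detecting [HasExt.{v} C] {X Y : C} (n : ℕ)
    (x : ((Ext R C (n + 1)).obj (op X)).obj Y) :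
    ∃ α : Abelian.Ext.{v} X Y (n + 1), ∀ {X' : C} (f : X' ⟶ X),
      (Abelian.Ext.mk₀ f).comp α (zero_add _) = 0 →
        ((Ext R C (n + 1)).map f.op).app Y x = 0 := by
  let P := projectiveResolution X
  let K := P.complex.linearYonedaObj R Y
  obtain ⟨c, hc⟩ := (ModuleCat.epi_iff_surjective (K.homologyπ (n + 1))).1 inferInstance
    ((P.isoExt (n + 1) Y).hom x)
  have hc' : K.d (n + 1) (n + 2) (K.iCycles (n + 1) c) = 0 := by
    rw [← ConcreteCategory.comp_apply, iCycles_d]; rfl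
  let k : P.complex.X (n + 1) ⟶ Y := K.iCycles (n + 1) c
  refine ⟨P.extMk k (n + 2) rfl hc', fun {X'} f hf ↦ ?_⟩
  let P' := projectiveResolution X'
  let φ : P'.Hom P f := ⟨ProjectiveResolution.lift f P' P,
    (ProjectiveResolution.lift_commutes_zero f P' P).trans
      (by rw [ChainComplex.single₀_map_f_zero]; rfl)⟩
  obtain ⟨g, hg⟩ := (ProjectiveResolution.extMk_eq_zero_iff _ _ _ _ _ n rfl).1
    ((ProjectiveResolution.mk₀_comp_extMk k _ rfl hc' φ).symm.trans hf)
  let K' := P'.complex.linearYonedaObj R Y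
  let ψ : K ⟶ K' := ChainComplex.linearYonedaMap R φ.hom Y
  let g' : K'.X n := g
  have h₁ : cyclesMap ψ (n + 1) c = K'.toCycles n (n + 1) g' := by
    apply (ModuleCat.mono_iff_injective (K'.iCycles (n + 1))).1 inferInstance
    rw [← ConcreteCategory.comp_apply, ← ConcreteCategory.comp_apply, cyclesMap_i, toCycles_i]
    exact hg.symm
  apply (ModuleCat.mono_iff_injective (P'.isoExt (R := R) (n + 1) Y).hom).1 inferInstance
  rw [← ConcreteCategory.comp_apply, P'.isoExt_hom_naturality P φ, ConcreteCategory.comp_apply,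
    ← hc, ← ConcreteCategory.comp_apply, homologyπ_naturality, ConcreteCategory.comp_apply, h₁,
    ← ConcreteCategory.comp_apply, toCycles_comp_homologyπ, map_zero]
  rfl

end DerivedFunctors

/-- Local cohomology vanishes if every class in `Ext (A ⧸ J ^ n) M` dies in `Ext (A ⧸ J ^ m) M` for
some `m ≥ n`. -/
lemma localCohomology.subsingleton_of_forall_exists {A : Type u} [CommRing A] (J : Ideal A)
    (i : ℕ) (M : ModuleCat.{u} A)
    (h : ∀ (n : ℕ) (x : ((Ext A (ModuleCat.{u} A) i).obj
      (op (ModuleCat.of A (A ⧸ J ^ n)))).obj M),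
      ∃ (m : ℕ) (hm : n ≤ m), ((Ext A (ModuleCat.{u} A) i).map
        ((ringModIdeals (idealPowersDiagram J)).map (homOfLE hm).op).op).app M x = 0) :
    Subsingleton ((localCohomology J i).obj M) := by
  let D := diagram (idealPowersDiagram J) i
  let ev := (evaluation (ModuleCat.{u} A) (ModuleCat.{u} A)).obj M
  have hc : IsColimit (ev.mapCocone (colimit.cocone D)) :=
    isColimitOfPreserves ev (colimit.isColimit D)
  have h0 (j : ℕᵒᵖᵒᵖ) : (ev.mapCocone (colimit.cocone D)).ι.app j = 0 := by
    ext x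
    obtain ⟨m, hm, hx⟩ := h (unop (unop j)) x
    have w := (ev.mapCocone (colimit.cocone D)).w (Quiver.Hom.op (homOfLE hm).op :
      j ⟶ op (op m))
    exact ((ConcreteCategory.congr_hom w x).symm.trans
      (congrArg ((ev.mapCocone (colimit.cocone D)).ι.app (op (op m))) hx)).trans (map_zero _)
  exact ModuleCat.subsingleton_of_isZero ((IsZero.iff_id_eq_zero _).2 (hc.hom_ext fun j ↦
    ((congrArg (· ≫ 𝟙 _) (h0 j)).trans zero_comp).trans comp_zero.symm))

/-- Local cohomology along an ideal that is generated up to radical by `s` vanishes in degrees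
greater than the number of elements of `s`. -/
lemma localCohomology.subsingleton_of_le_radical_span {A : Type u} [CommRing A]
    [IsNoetherianRing A] (J : Ideal A) (s : Finset A) (hs : (s : Set A) ⊆ J)
    (hJ : J ≤ (Ideal.span (s : Set A)).radical) (i : ℕ) (hi : s.card ≤ i) (M : ModuleCat.{u} A) :
    Subsingleton ((localCohomology J (i + 1)).obj M) := by
  refine localCohomology.subsingleton_of_forall_exists J (i + 1) M fun n x ↦ ?_
  obtain ⟨α, hα⟩ := exists_abelianExt_detecting i x
  let I := injectiveResolution M
  obtain ⟨f, hf, rfl⟩ := I.extMk_surjective α (i + 2) rfl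
  have : ∀ k, Module.Injective A (I.cocomplex.X k) := fun k ↦
    have : Injective (ModuleCat.of A (I.cocomplex.X k)) := I.injective k
    Module.injective_module_of_injective_object A _
  have hz (a : A) (ha : a ∈ J ^ n) : a • f (Submodule.Quotient.mk 1) = 0 := by
    have h1 : a • (Submodule.Quotient.mk 1 : A ⧸ J ^ n) = 0 := by
      rw [← Submodule.Quotient.mk_smul, Submodule.Quotient.mk_eq_zero]
      simpa using ha
    exact (f.hom.map_smul a _).symm.trans ((congrArg f.hom h1).trans (map_zero f.hom))
  obtain ⟨y, hy, hyz⟩ := exists_isPowerTorsion_of_exact (E := fun k ↦ I.cocomplex.X k)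
    (fun k ↦ (I.cocomplex.d k (k + 1)).hom)
    (fun k ↦ (ShortComplex.ShortExact.moduleCat_exact_iff_function_exact _).1 (I.exact_succ k))
    s i hi (f (Submodule.Quotient.mk 1)) (fun a ha ↦ ⟨n, hz _ (Ideal.pow_mem_pow (hs ha) n)⟩)
    (ConcreteCategory.congr_hom hf _)
  obtain ⟨m, hm⟩ := hy.exists_pow_smul_eq_zero hJ
  refine ⟨max n m, le_max_left n m, hα _ ?_⟩
  have hle : J ^ max n m ≤ LinearMap.ker (LinearMap.toSpanSingleton A (I.cocomplex.X i) y) :=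
    fun a ha ↦ hm a (Ideal.pow_le_pow_right (le_max_right n m) ha)
  refine (I.mk₀_comp_extMk f (i + 2) rfl hf _).trans
    ((I.extMk_eq_zero_iff _ _ _ _ i rfl).2 ⟨ModuleCat.ofHom (Submodule.liftQ _ _ hle), ?_⟩)
  refine ModuleCat.hom_ext (Submodule.linearMap_qext _ (LinearMap.ext_ring ?_))
  refine Eq.trans ?_ hyz
  exact congrArg (I.cocomplex.d i (i + 1)).hom (one_smul A y)

end LocalCohomology

lemma LaurentPolynomial.isNoetherianRing (R : Type*) [CommRing R] [IsNoetherianRing R] :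
    IsNoetherianRing (LaurentPolynomial R) :=
  IsLocalization.isNoetherianRing (Submonoid.powers (Polynomial.X : Polynomial R)) _ inferInstance

open LaurentPolynomial IsLocalRing

/-- Let `(R,𝔪)` be a Noetherian local ring with `ringKrullDim R = d`,
`A = R[t,t⁻¹]`, and `J = 𝔪·A`.  Then `H^{d+1}_J(A) = 0`. -/
theorem localCohomology_laurent_top_vanishing
    {R : Type} [CommRing R] [IsNoetherianRing R] [IsLocalRing R]
    (d : ℕ) (hd : ringKrullDim R = d)
    (J : Ideal (LaurentPolynomial R))
    (hJ : J = (maximalIdeal R).map (algebraMap R (LaurentPolynomial R))) :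
    Subsingleton
      ((localCohomology J (d + 1)).obj
        (ModuleCat.of (LaurentPolynomial R) (LaurentPolynomial R))) := by
  classical
  subst hJ
  have := LaurentPolynomial.isNoetherianRing R
  obtain ⟨s, hcard, hs, hrad⟩ := IsLocalRing.exists_finset_maximalIdeal_le_radical d hd
  refine localCohomology.subsingleton_of_le_radical_span _
    (s.image (algebraMap R (LaurentPolynomial R))) ?_ ?_ d (hcard ▸ Finset.card_image_le) _
  · intro a ha
    obtain ⟨b, hb, rfl⟩ := Finset.mem_image.1 ha
    exact Ideal.mem_map_of_mem _ (hs hb)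
  · rw [Finset.coe_image, ← Ideal.map_span]
    exact (Ideal.map_mono hrad).trans (Ideal.map_radical_le _)
end

section
/- Let S_+ denote the ideal of S generated by the elements C a * T 1 for a ∈ 𝔞. Then for every f ∈ T𝔞 there exists n : ℕ such that g·f ∈ S (the product computed in A) for every g ∈ S_+^n; that is, the S-module T𝔞/S is S_+-torsion. -/
set_option synthInstance.maxHeartbeats 1000000
set_option maxHeartbeats 1000000
open LaurentPolynomial

/-- Let `S = R[𝔞t]` be the Rees algebra and `T𝔞 = R[𝔞t,t⁻¹]` the extended
Rees algebra inside `A = R[t,t⁻¹]`, and let `S₊ ⊆ S` be the ideal generated by the elements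
`C a * T 1`, `a ∈ 𝔞`.  Every `f ∈ T𝔞` is killed into `S` by a power of `S₊`:
the `S`-module `T𝔞/S` is `S₊`-torsion. -/
theorem extendedRees_quotient_is_irrelevant_torsion
    {R : Type*} [CommRing R] (𝔞 : Ideal R)
    (S : Subalgebra R (LaurentPolynomial R))
    (hS : S = Algebra.adjoin R {x : LaurentPolynomial R | ∃ a ∈ 𝔞, C a * T 1 = x})
    (T𝔞 : Subalgebra R (LaurentPolynomial R))
    (hT𝔞 : T𝔞 = Algebra.adjoin R
      ({x : LaurentPolynomial R | ∃ a ∈ 𝔞, C a * T 1 = x} ∪ {T (-1)}))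
    (Splus : Ideal S)
    (hSplus : Splus = Ideal.span {y : S | ∃ a ∈ 𝔞, (y : LaurentPolynomial R) = C a * T 1})
    (f : LaurentPolynomial R) (hf : f ∈ T𝔞) :
    ∃ n : ℕ, ∀ g ∈ Splus ^ n, (g : LaurentPolynomial R) * f ∈ S := by
  subst hT𝔞
  induction hf using Algebra.adjoin_induction with
  | mem x hx =>
    rcases hx with hx | rfl
    · have hxS : x ∈ S := hS ▸ Algebra.subset_adjoin hx
      exact ⟨0, fun g _ => S.mul_mem g.2 hxS⟩
    · refine ⟨1, fun g hg => ?_⟩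
      rw [pow_one, hSplus] at hg
      induction hg using Submodule.span_induction with
      | mem y hy =>
        obtain ⟨a, -, hy⟩ := hy
        rw [hy, mul_assoc, ← T_add, add_neg_cancel, T_zero, mul_one]
        exact S.algebraMap_mem a
      | zero => simp
      | add y z _ _ hy hz => simpa only [Subalgebra.coe_add, add_mul] using S.add_mem hy hz
      | smul s y _ hy =>
        simpa only [smul_eq_mul, Subalgebra.coe_mul, mul_assoc] using S.mul_mem s.2 hy
  | algebraMap r => exact ⟨0, fun g _ => S.mul_mem g.2 (S.algebraMap_mem r)⟩
  | add x y _ _ hx hy =>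
    obtain ⟨m, hm⟩ := hx
    obtain ⟨n, hn⟩ := hy
    refine ⟨m + n, fun g hg => ?_⟩
    rw [mul_add]
    exact S.add_mem (hm g (Ideal.pow_le_pow_right (Nat.le_add_right m n) hg))
      (hn g (Ideal.pow_le_pow_right (Nat.le_add_left n m) hg))
  | mul x y _ _ hx hy =>
    obtain ⟨m, hm⟩ := hx
    obtain ⟨n, hn⟩ := hy
    refine ⟨m + n, fun g hg => ?_⟩
    rw [pow_add] at hg
    induction hg using Submodule.mul_induction_on' with
    | mem_mul_mem g hg h hh =>
      rw [Subalgebra.coe_mul, mul_mul_mul_comm]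
      exact S.mul_mem (hm g hg) (hn h hh)
    | add g _ h _ hg hh => simpa only [Subalgebra.coe_add, add_mul] using S.add_mem hg hh
end

section
/- Assume 𝔞 ≠ R. Then for every n : ℕ and every x : R, the element C x * T (-n) of the extended Rees algebra T𝔞 lies in the ideal 𝔪_S·T𝔞 if and only if x ∈ 𝔪. (Equivalently, in each degree −n ≤ 0 the graded component of 𝔪_S·T𝔞 equals 𝔪.) -/
set_option synthInstance.maxHeartbeats 1000000
set_option maxHeartbeats 1000000

open LaurentPolynomial IsLocalRing

/-- Let `(R,𝔪)` be a local ring and `𝔞 ⊊ R` a proper ideal, `T𝔞 = R[𝔞t,t⁻¹]`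
the extended Rees algebra and `𝔪_S·T𝔞` the ideal of `T𝔞` generated by the `C x`, `x ∈ 𝔪`,
and the `C a * T 1`, `a ∈ 𝔞`.  For every `n : ℕ` and `x : R`, the element `C x * T (-n)` of
`T𝔞` lies in `𝔪_S·T𝔞` iff `x ∈ 𝔪`: in each degree `-n ≤ 0` the graded component of
`𝔪_S·T𝔞` equals `𝔪`. -/
theorem extendedRees_irrelevant_ideal_nonpositive_components
    {R : Type*} [CommRing R] [IsLocalRing R] (𝔞 : Ideal R) (h𝔞 : 𝔞 ≠ ⊤)
    (T𝔞 : Subalgebra R (LaurentPolynomial R))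
    (hT𝔞 : T𝔞 = Algebra.adjoin R
      ({x : LaurentPolynomial R | ∃ a ∈ 𝔞, C a * T 1 = x} ∪ {T (-1)}))
    (I : Ideal T𝔞)
    (hI : I = Ideal.span
      ({y : T𝔞 | ∃ x ∈ maximalIdeal R, (y : LaurentPolynomial R) = C x} ∪
        {y : T𝔞 | ∃ a ∈ 𝔞, (y : LaurentPolynomial R) = C a * T 1}))
    (n : ℕ) (x : R) (y : T𝔞) (hy : (y : LaurentPolynomial R) = C x * T (-(n : ℤ))) :
    y ∈ I ↔ x ∈ maximalIdeal R := by
  have hsub : I ≤ RingHom.ker ((eval₂ (residue R) 1).comp T𝔞.subtype) := by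
    rw [hI, Ideal.span_le]
    rintro z (⟨r, hr, hz⟩ | ⟨a, ha, hz⟩)
    · simp [RingHom.mem_ker, hz, (residue_eq_zero_iff r).2 hr]
    · simp [RingHom.mem_ker, hz, (residue_eq_zero_iff a).2 (le_maximalIdeal h𝔞 ha)]
  constructor
  · intro hyI
    have h : eval₂ (residue R) 1 (y : LaurentPolynomial R) = 0 := hsub hyI
    exact (residue_eq_zero_iff x).1 (by simpa [hy] using h)
  · intro hx
    have hT : (T (-1) : LaurentPolynomial R) ∈ T𝔞 :=
      hT𝔞 ▸ Algebra.subset_adjoin (Or.inr rfl)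
    have hC : C x ∈ T𝔞 := T𝔞.algebraMap_mem x
    have hy' : y = ⟨T (-1), hT⟩ ^ n * ⟨C x, hC⟩ := by
      ext1
      rw [hy, mul_comm, MulMemClass.coe_mul, SubmonoidClass.coe_pow, T_pow, mul_neg_one]
    rw [hy', hI]
    exact Ideal.mul_mem_left _ _ (Ideal.subset_span (Or.inl ⟨x, hx, rfl⟩))
end

section
/- Assume R is nontrivial and 𝔞 ≠ R. Then the quotient ring T𝔞 ⧸ (𝔪_S·T𝔞) is not finitely generated as an R-module; equivalently, it is an infinite-dimensional vector space over the residue field R/𝔪. In particular, the ideal 𝔪_S·T𝔞 is not 𝔪_T-primary. -/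
set_option synthInstance.maxHeartbeats 1000000
set_option maxHeartbeats 1000000

open LaurentPolynomial IsLocalRing

/-- Let `(R,𝔪)` be a nontrivial local ring and `𝔞 ⊊ R` a proper ideal,
`T𝔞 = R[𝔞t,t⁻¹]` the extended Rees algebra, `𝔪_S·T𝔞` the ideal of `T𝔞` generated by the
`C x`, `x ∈ 𝔪`, and the `C a * T 1`, `a ∈ 𝔞`, and `𝔪_T` the maximal homogeneous ideal of
`T𝔞`.  Then `T𝔞 ⧸ 𝔪_S·T𝔞` is not a finitely generated `R`-module; in particular
`𝔪_S·T𝔞` is not `𝔪_T`-primary. -/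
theorem extendedRees_quotient_by_irrelevant_not_finite
    {R : Type*} [CommRing R] [Nontrivial R] [IsLocalRing R] (𝔞 : Ideal R) (h𝔞 : 𝔞 ≠ ⊤)
    (T𝔞 : Subalgebra R (LaurentPolynomial R))
    (hT𝔞 : T𝔞 = Algebra.adjoin R
      ({x : LaurentPolynomial R | ∃ a ∈ 𝔞, C a * T 1 = x} ∪ {T (-1)}))
    (I 𝔪T : Ideal T𝔞)
    (hI : I = Ideal.span
      ({y : T𝔞 | ∃ x ∈ maximalIdeal R, (y : LaurentPolynomial R) = C x} ∪
        {y : T𝔞 | ∃ a ∈ 𝔞, (y : LaurentPolynomial R) = C a * T 1}))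
    (h𝔪T : 𝔪T = Ideal.span
      ({y : T𝔞 | ∃ x ∈ maximalIdeal R, (y : LaurentPolynomial R) = C x} ∪
        {y : T𝔞 | ∃ a ∈ 𝔞, (y : LaurentPolynomial R) = C a * T 1} ∪
        {y : T𝔞 | (y : LaurentPolynomial R) = T (-1)})) :
    ¬ Module.Finite R (T𝔞 ⧸ I) ∧ ¬ (I.IsPrimary ∧ I.radical = 𝔪T) := by
  let u : (LaurentPolynomial (ResidueField R))ˣ :=
    ⟨T (-1), T 1, by rw [← T_add, neg_add_cancel, T_zero],
      by rw [← T_add, add_neg_cancel, T_zero]⟩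
  let φ : LaurentPolynomial R →+* LaurentPolynomial (ResidueField R) :=
    eval₂ ((C : ResidueField R →+* LaurentPolynomial (ResidueField R)).comp (residue R)) u
  have hφC (x : R) : φ (C x) = C (residue R x) := eval₂_C _ _ _
  have hφT : φ (T (-1)) = T 1 := by
    rw [eval₂_T, zpow_neg_one]
    rfl
  have hφm {x : R} (hx : x ∈ maximalIdeal R) : φ (C x) = 0 := by
    rw [hφC, (residue_eq_zero_iff x).2 hx, map_zero]
  have hIφ : ∀ y ∈ I, (φ.comp (algebraMap T𝔞 (LaurentPolynomial R))) y = 0 := by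
    change I ≤ RingHom.ker _
    rw [hI, Ideal.span_le]
    rintro y (⟨x, hx, hy⟩ | ⟨a, ha, hy⟩)
    · change φ (y : LaurentPolynomial R) = 0
      rw [hy, hφm hx]
    · change φ (y : LaurentPolynomial R) = 0
      rw [hy, map_mul, hφm (le_maximalIdeal h𝔞 ha), zero_mul]
  have hTmem : (T (-1) : LaurentPolynomial R) ∈ T𝔞 :=
    hT𝔞 ▸ Algebra.subset_adjoin (Or.inr rfl)
  let s : T𝔞 := ⟨T (-1), hTmem⟩
  refine ⟨fun hfin ↦ ?_, fun ⟨_, hrad⟩ ↦ ?_⟩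
  · obtain ⟨p, hp, hps⟩ := Algebra.IsIntegral.isIntegral (R := R) (Ideal.Quotient.mk I s)
    have h := congrArg (Ideal.Quotient.lift I _ hIφ) hps
    have hcomp : (Ideal.Quotient.lift I _ hIφ).comp (algebraMap R (T𝔞 ⧸ I)) =
        (C : ResidueField R →+* LaurentPolynomial (ResidueField R)).comp (residue R) :=
      RingHom.ext hφC
    have hs : Ideal.Quotient.lift I _ hIφ (Ideal.Quotient.mk I s) = T 1 := hφT
    rw [Polynomial.hom_eval₂, map_zero, hcomp, hs, ← Polynomial.eval₂_map] at h
    refine (hp.map (residue R)).ne_zero (Polynomial.toLaurent_injective ?_)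
    rw [map_zero, ← h]
    induction p.map (residue R) using Polynomial.induction_on' with
    | add p q hp hq => simp [hp, hq, Polynomial.eval₂_add]
    | monomial n a => simp [Polynomial.eval₂_monomial, T_pow, Polynomial.toLaurent_C_mul_T]
  · have hs : s ∈ I.radical := by
      rw [hrad, h𝔪T]
      exact Ideal.subset_span (Or.inr rfl)
    obtain ⟨n, hn⟩ := hs
    have h := hIφ _ hn
    rw [map_pow] at h
    change φ (T (-1)) ^ n = 0 at h
    rw [hφT] at h
    exact ((isUnit_T (R := ResidueField R) 1).pow n).ne_zero h
end

section
/- Let d : ℕ with d ≥ 2, and assume ringKrullDim R = d, 𝔞 ≠ R, and 𝔞 has positive height. Then H^{d+1}_{𝔪_S·T𝔞}(T𝔞) = 0, i.e. the (d+1)-st local cohomology of the extended Rees algebra T𝔞 (as a module over itself) along the ideal 𝔪_S·T𝔞 is the trivial module. -/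
set_option synthInstance.maxHeartbeats 1000000
set_option maxHeartbeats 1000000

open LaurentPolynomial IsLocalRing

noncomputable section LocalCohomology

open CategoryTheory Limits

universe u
variable {R : Type u} [CommRing R]

theorem unop_hom_congr {A B : (ModuleCat.{u} R)ᵒᵖ} {f g : A ⟶ B} (h : f = g) (x : B.unop) :
    f.unop.hom x = g.unop.hom x := by rw [h]

/-- A class in positive degree in a contravariant derived functor is represented by a cocycle, and
its restriction along `g` vanishes once the restricted cocycle is a coboundary. -/
theorem leftDerived_exists_cocycle (F : ModuleCat.{u} R ⥤ (ModuleCat.{u} R)ᵒᵖ) [F.Additive]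
    {X : ModuleCat.{u} R} (n : ℕ) (P : ProjectiveResolution X)
    (α : ((F.leftDerived (n + 1)).obj X).unop) :
    ∃ b : (F.obj (P.complex.X (n + 1))).unop,
      (F.map (P.complex.d (n + 2) (n + 1))).unop.hom b = 0 ∧
      ∀ {X' : ModuleCat.{u} R} (g : X' ⟶ X) (P' : ProjectiveResolution X')
        (φ : P'.complex ⟶ P.complex) (_ : φ.f 0 ≫ P.π.f 0 = P'.π.f 0 ≫ g)
        (ψ : (F.obj (P'.complex.X n)).unop),
        (F.map (φ.f (n + 1))).unop.hom b = (F.map (P'.complex.d (n + 1) n)).unop.hom ψ →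
        ((F.leftDerived (n + 1)).map g).unop.hom α = 0 := by
  set K := (F.mapHomologicalComplex (ComplexShape.down ℕ)).obj P.complex
  obtain ⟨γ, rfl⟩ := (ModuleCat.epi_iff_surjective (P.isoLeftDerivedObj F (n + 1)).hom.unop).1
    inferInstance α
  obtain ⟨δ, rfl⟩ := (ModuleCat.epi_iff_surjective (K.homologyι (n + 1)).unop).1 inferInstance γ
  refine ⟨(K.pOpcycles (n + 1)).unop δ, unop_hom_congr (K.d_pOpcycles (n + 2) (n + 1)) δ, ?_⟩
  intro X' g P' φ hφ ψ h
  set K' := (F.mapHomologicalComplex (ComplexShape.down ℕ)).obj P'.complex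
  set Φ : K' ⟶ K := (F.mapHomologicalComplex (ComplexShape.down ℕ)).map φ
  have nat := P'.isoLeftDerivedObj_hom_naturality g P φ hφ F (n + 1)
  have h1 : (HomologicalComplex.opcyclesMap Φ (n + 1)).unop.hom δ =
      (K'.fromOpcycles (n + 1) n).unop.hom ψ :=
    (ModuleCat.mono_iff_injective (K'.pOpcycles (n + 1)).unop).1 inferInstance
      ((unop_hom_congr (HomologicalComplex.p_opcyclesMap Φ (n + 1)) δ).trans
        (h.trans (unop_hom_congr (K'.p_fromOpcycles (n + 1) n) ψ).symm))
  have h2 : (HomologicalComplex.homologyMap Φ (n + 1)).unop.hom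
      ((K.homologyι (n + 1)).unop.hom δ) = 0 :=
    (unop_hom_congr (HomologicalComplex.homologyι_naturality Φ (n + 1)) δ).trans
      ((congrArg (K'.homologyι (n + 1)).unop.hom h1).trans
        (unop_hom_congr (K'.homologyι_comp_fromOpcycles (n + 1) n) ψ))
  exact (unop_hom_congr nat ((K.homologyι (n + 1)).unop.hom δ)).trans
    ((congrArg (P'.isoLeftDerivedObj F (n + 1)).hom.unop.hom h2).trans (map_zero _))

/-- An `Ext` class in positive degree is represented by a cocycle, and its restriction along `g`
vanishes once the restricted cocycle is a coboundary. -/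
theorem ext_exists_cocycle {X Y : ModuleCat.{u} R} (n : ℕ) (P : ProjectiveResolution X)
    (α : ((Ext R (ModuleCat.{u} R) (n + 1)).obj (Opposite.op X)).obj Y) :
    ∃ b : P.complex.X (n + 1) ⟶ Y, P.complex.d (n + 2) (n + 1) ≫ b = 0 ∧
      ∀ {X' : ModuleCat.{u} R} (g : X' ⟶ X) (P' : ProjectiveResolution X')
        (φ : P'.complex ⟶ P.complex) (_ : φ.f 0 ≫ P.π.f 0 = P'.π.f 0 ≫ g)
        (ψ : P'.complex.X n ⟶ Y),
        φ.f (n + 1) ≫ b = P'.complex.d (n + 1) n ≫ ψ →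
        (((Ext R (ModuleCat.{u} R) (n + 1)).map g.op).app Y) α = 0 :=
  leftDerived_exists_cocycle ((linearYoneda R (ModuleCat.{u} R)).obj Y).rightOp n P α

/-- The module `R ⧸ I ^ k`. -/
abbrev quotPow (I : Ideal R) (k : ℕ) : ModuleCat.{u} R := ModuleCat.of R (R ⧸ I ^ k)

/-- The projection `R ⧸ I ^ m ⟶ R ⧸ I ^ k` for `k ≤ m`. -/
abbrev quotPowMap (I : Ideal R) {k m : ℕ} (h : k ≤ m) : quotPow I m ⟶ quotPow I k :=
  ModuleCat.ofHom (Submodule.mapQ _ _ LinearMap.id (Ideal.pow_le_pow_right h))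

/-- The chosen projective resolution of `R ⧸ I ^ k`. -/
abbrev quotPowRes (I : Ideal R) (k : ℕ) : ProjectiveResolution (quotPow I k) :=
  projectiveResolution (quotPow I k)

/-- The augmentation of a projective resolution, in degree `0`. -/
abbrev resAug {X : ModuleCat.{u} R} (P : ProjectiveResolution X) : P.complex.X 0 ⟶ X := P.π.f 0

/-- Every `(n + 1)`-cocycle of `R ⧸ I ^ k` with values in `M` becomes a coboundary on `R ⧸ I ^ m`
for some `m ≥ k`. -/
def CocyclesDie (I : Ideal R) (n : ℕ) (M : ModuleCat.{u} R) : Prop :=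
  ∀ (k : ℕ) (b : (quotPowRes I k).complex.X (n + 1) ⟶ M),
    (quotPowRes I k).complex.d (n + 2) (n + 1) ≫ b = 0 →
    ∃ (m : ℕ) (h : k ≤ m) (φ : (quotPowRes I m).complex ⟶ (quotPowRes I k).complex)
      (ψ : (quotPowRes I m).complex.X n ⟶ M),
      φ.f 0 ≫ resAug (quotPowRes I k) = resAug (quotPowRes I m) ≫ quotPowMap I h ∧
      φ.f (n + 1) ≫ b = (quotPowRes I m).complex.d (n + 1) n ≫ ψ

theorem CocyclesDie.subsingleton_localCohomology {R : Type} [CommRing R] {I : Ideal R} {n : ℕ}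
    {M : ModuleCat.{0} R} (H : CocyclesDie I n M) :
    Subsingleton ((localCohomology I (n + 1)).obj M) := by
  have : HasColimit (localCohomology.diagram (localCohomology.idealPowersDiagram I) (n + 1)) :=
    localCohomology.hasColimitDiagram.{0, 0} _ _
  set G := localCohomology.diagram (localCohomology.idealPowersDiagram I) (n + 1)
  let ev := (evaluation (ModuleCat.{0} R) (ModuleCat.{0} R)).obj M
  have hc := isColimitOfPreserves ev (colimit.isColimit G)
  refine subsingleton_of_forall_eq 0 fun x ↦ ?_
  obtain ⟨j, α, rfl⟩ := Concrete.isColimit_exists_rep _ hc x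
  obtain ⟨b, hb, hb'⟩ := ext_exists_cocycle n (quotPowRes I j.unop.unop) α
  obtain ⟨m, h, φ, ψ, hφ, hψ⟩ := H _ b hb
  have h0 := hb' _ _ φ hφ ψ hψ
  let j' : ℕᵒᵖᵒᵖ := .op (.op m)
  let e : j ⟶ j' := ((homOfLE h).op).op
  have h1 := congrArg (fun f ↦ f.hom α) ((ev.mapCocone (colimit.cocone G)).w e)
  refine h1.symm.trans ?_
  exact (congrArg ((ev.mapCocone (colimit.cocone G)).ι.app j').hom h0).trans (map_zero _)

theorem CocyclesDie.succ {I : Ideal R} {n : ℕ} {M E Z : ModuleCat.{u} R} [Injective E]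
    (ε : M ⟶ E) [Mono ε] (π : E ⟶ Z) [Epi π] (w : ε ≫ π = 0) (hex : (ShortComplex.mk ε π w).Exact)
    (H : CocyclesDie I n Z) : CocyclesDie I (n + 1) M := by
  intro k b hb
  have hb' : (quotPowRes I k).complex.d (n + 3) (n + 2) ≫ (b ≫ ε) = 0 := by
    rw [← Category.assoc]
    exact (congrArg (· ≫ ε) hb).trans zero_comp
  obtain ⟨ψ₀, hψ₀⟩ : ∃ ψ₀ : (quotPowRes I k).complex.X (n + 1) ⟶ E,
      (quotPowRes I k).complex.d (n + 2) (n + 1) ≫ ψ₀ = b ≫ ε :=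
    ⟨_, ((quotPowRes I k).exact_succ (n + 1)).comp_descToInjective (b ≫ ε) hb'⟩
  obtain ⟨m, h, φ, χ, hφ, hχ⟩ := H k (ψ₀ ≫ π) (by
    rw [← Category.assoc, hψ₀, Category.assoc, w, comp_zero])
  obtain ⟨l, hl⟩ : ∃ l : (quotPowRes I m).complex.X n ⟶ E, l ≫ π = χ :=
    ⟨_, Projective.factorThru_comp χ π⟩
  obtain ⟨ψ, hψ⟩ : ∃ ψ : (quotPowRes I m).complex.X (n + 1) ⟶ M,
      ψ ≫ ε = φ.f (n + 1) ≫ ψ₀ - (quotPowRes I m).complex.d (n + 1) n ≫ l :=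
    ⟨_, hex.lift_f (φ.f (n + 1) ≫ ψ₀ - (quotPowRes I m).complex.d (n + 1) n ≫ l) (by
      simp only [Preadditive.sub_comp, Category.assoc, hl, hχ, sub_self])⟩
  refine ⟨m, h, φ, ψ, hφ, ?_⟩
  rw [← cancel_mono ε, Category.assoc, Category.assoc, hψ, ← hψ₀]
  simp

theorem CocyclesDie.zero {I : Ideal R} {M E Z : ModuleCat.{u} R} [Injective E]
    (ε : M ⟶ E) [Mono ε] (π : E ⟶ Z) (w : ε ≫ π = 0) (hex : (ShortComplex.mk ε π w).Exact)
    (H : ∀ z : Z, ∀ k, (∀ r ∈ I ^ k, r • z = 0) →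
      ∃ e : E, π.hom e = z ∧ ∃ m, ∀ r ∈ I ^ m, r • e = 0) :
    CocyclesDie I 0 M := by
  intro k b hb
  have hb' : (quotPowRes I k).complex.d 2 1 ≫ (b ≫ ε) = 0 := by
    rw [← Category.assoc]
    exact (congrArg (· ≫ ε) hb).trans zero_comp
  obtain ⟨ψ₀, hψ₀⟩ : ∃ ψ₀ : (quotPowRes I k).complex.X 0 ⟶ E,
      (quotPowRes I k).complex.d 1 0 ≫ ψ₀ = b ≫ ε :=
    ⟨_, ((quotPowRes I k).exact_succ 0).comp_descToInjective (b ≫ ε) hb'⟩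
  obtain ⟨c, hc⟩ : ∃ c : quotPow I k ⟶ Z, resAug (quotPowRes I k) ≫ c = ψ₀ ≫ π :=
    ⟨_, (quotPowRes I k).exact₀.g_desc (ψ₀ ≫ π)
      (by rw [← Category.assoc, hψ₀, Category.assoc, w, comp_zero])⟩
  obtain ⟨e, he, m, hm⟩ := H (c.hom (Submodule.Quotient.mk 1)) k (by
    intro r hr
    rw [← map_smul, ← Submodule.Quotient.mk_smul, smul_eq_mul, mul_one,
      (Submodule.Quotient.mk_eq_zero _).2 hr, map_zero])
  have hkm : k ≤ max m k := le_max_right _ _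
  let e' : quotPow I (max m k) ⟶ E := ModuleCat.ofHom
    (Submodule.liftQ (I ^ (max m k)) (LinearMap.toSpanSingleton R E e) (by
      intro r hr
      exact hm r (Ideal.pow_le_pow_right (le_max_left _ _) hr)))
  have he' : e' ≫ π = quotPowMap I hkm ≫ c := by
    refine ModuleCat.hom_ext (LinearMap.ext fun x ↦ ?_)
    obtain ⟨r, rfl⟩ := Submodule.Quotient.mk_surjective _ x
    change π.hom (r • e) = c.hom (Submodule.Quotient.mk r)
    rw [map_smul, he, ← map_smul, ← Submodule.Quotient.mk_smul, smul_eq_mul, mul_one]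
  let φ := ProjectiveResolution.lift (quotPowMap I hkm) (quotPowRes I (max m k)) (quotPowRes I k)
  have hφ : φ.f 0 ≫ resAug (quotPowRes I k) =
      resAug (quotPowRes I (max m k)) ≫ quotPowMap I hkm :=
    ProjectiveResolution.lift_commutes_zero _ _ _
  obtain ⟨ψ, hψ⟩ : ∃ ψ : (quotPowRes I (max m k)).complex.X 0 ⟶ M,
      ψ ≫ ε = φ.f 0 ≫ ψ₀ - resAug (quotPowRes I (max m k)) ≫ e' :=
    ⟨_, hex.lift_f (φ.f 0 ≫ ψ₀ - resAug (quotPowRes I (max m k)) ≫ e') (by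
      rw [Preadditive.sub_comp, Category.assoc, Category.assoc, he', ← hc, ← Category.assoc, hφ,
        Category.assoc, sub_self])⟩
  have hd : (quotPowRes I (max m k)).complex.d 1 0 ≫ resAug (quotPowRes I (max m k)) = 0 :=
    (quotPowRes I (max m k)).complex_d_comp_π_f_zero
  refine ⟨max m k, hkm, φ, ψ, hφ, ?_⟩
  rw [← cancel_mono ε, Category.assoc, Category.assoc, hψ, ← hψ₀, Preadditive.comp_sub,
    ← Category.assoc (φ.f (0 + 1)), φ.comm 1 0, ← Category.assoc _ _ e', hd, zero_comp, sub_zero,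
    Category.assoc]

/-- An injective module extends maps along any (not necessarily injective) map with a smaller
kernel. -/
theorem exists_comp_eq_of_ker_le {A B E : Type u} [AddCommGroup A] [Module R A]
    [AddCommGroup B] [Module R B] [AddCommGroup E] [Module R E] [Module.Injective R E]
    (μ : A →ₗ[R] B) (ψ : A →ₗ[R] E) (h : LinearMap.ker μ ≤ LinearMap.ker ψ) :
    ∃ θ : B →ₗ[R] E, ∀ a, θ (μ a) = ψ a := by
  obtain ⟨θ, hθ⟩ := Module.Injective.out ((LinearMap.ker μ).liftQ μ le_rfl)
    (by rw [← LinearMap.ker_eq_bot]; exact Submodule.ker_liftQ_eq_bot _ _ _ le_rfl)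
    ((LinearMap.ker μ).liftQ ψ h)
  exact ⟨θ, fun a ↦ hθ (Submodule.Quotient.mk a)⟩

/-- Elements killed by some power of each member of `F`. -/
def IsPowTorsion {M : Type*} [AddCommGroup M] [Module R M] (F : List R) (e : M) : Prop :=
  ∀ f ∈ F, ∃ k : ℕ, f ^ k • e = 0

/-- Up to `f`-power torsion, the `F`-torsion of an injective module is `f`-divisible. -/
theorem IsPowTorsion.exists_pow_smul_sub [IsNoetherianRing R] {E : Type u} [AddCommGroup E]
    [Module R E] [Module.Injective R E] {F : List R} {e : E} (he : IsPowTorsion F e) (f : R)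
    (k : ℕ) : ∃ a : E, IsPowTorsion F a ∧ ∃ p : ℕ, f ^ p • (f ^ k • a - e) = 0 := by
  let 𝔟 : Ideal R := LinearMap.ker (LinearMap.toSpanSingleton R E e)
  have h𝔟 : ∀ r, r ∈ 𝔟 ↔ r • e = 0 := fun r ↦ by simp [𝔟]
  let J : ℕ →o Ideal R :=
    ⟨fun n ↦ Submodule.comap (LinearMap.mulLeft R (f ^ n)) 𝔟, fun m n hmn r hr ↦ by
      simp only [Submodule.mem_comap, LinearMap.mulLeft_apply] at hr ⊢
      obtain ⟨c, rfl⟩ := Nat.exists_eq_add_of_le hmn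
      rw [pow_add, mul_comm (f ^ m), mul_assoc]
      exact 𝔟.mul_mem_left _ hr⟩
  obtain ⟨p, hp⟩ := monotone_stabilizes_iff_noetherian.2 ‹IsNoetherianRing R› J
  obtain ⟨θ, hθ⟩ := exists_comp_eq_of_ker_le (𝔟.mkQ ∘ₗ LinearMap.mulLeft R (f ^ (p + k)))
    (LinearMap.toSpanSingleton R E e ∘ₗ LinearMap.mulLeft R (f ^ p)) (fun r hr ↦ by
      have h1 : r ∈ J (p + k) :=
        (Submodule.Quotient.mk_eq_zero 𝔟).1 (LinearMap.mem_ker.1 hr)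
      rw [← hp _ (Nat.le_add_right p k)] at h1
      exact h1)
  refine ⟨θ (𝔟.mkQ 1), fun g hg ↦ ?_, p, ?_⟩
  · obtain ⟨n, hn⟩ := he g hg
    refine ⟨n, ?_⟩
    rw [← map_smul, ← map_smul, smul_eq_mul, mul_one, Submodule.mkQ_apply,
      (Submodule.Quotient.mk_eq_zero _).2 ((h𝔟 _).2 hn), map_zero]
  · have h1 : θ (𝔟.mkQ (f ^ (p + k))) = f ^ p • e := by simpa using hθ 1
    rw [smul_sub, ← mul_smul, ← pow_add, ← h1, ← map_smul, ← map_smul, smul_eq_mul, mul_one,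
      sub_self]

/-- In an injective resolution with cosyzygies `Z j`, torsion elements of `Z (j + 1)` lift to
torsion elements once `j` is at least the length of `F`. -/
theorem IsPowTorsion.exists_lift [IsNoetherianRing R] {Z E : ℕ → Type u}
    [∀ j, AddCommGroup (Z j)] [∀ j, Module R (Z j)] [∀ j, AddCommGroup (E j)]
    [∀ j, Module R (E j)] [∀ j, Module.Injective R (E j)]
    (ε : ∀ j, Z j →ₗ[R] E j) (π : ∀ j, E j →ₗ[R] Z (j + 1))
    (hε : ∀ j, Function.Injective (ε j)) (hπ : ∀ j, Function.Surjective (π j))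
    (hex : ∀ j, Function.Exact (ε j) (π j)) (F : List R) :
    ∀ (j : ℕ) (_ : F.length ≤ j) (z : Z (j + 1)), IsPowTorsion F z →
      ∃ e : E j, π j e = z ∧ IsPowTorsion F e := by
  induction F with
  | nil =>
    intro j _ z _
    obtain ⟨e, he⟩ := hπ j z
    exact ⟨e, he, by simp [IsPowTorsion]⟩
  | cons f F ih =>
    intro j hj z hz
    obtain ⟨j, rfl⟩ : ∃ i, j = i + 1 := Nat.exists_eq_succ_of_ne_zero (by
      simp only [List.length_cons] at hj; omega)
    have hj' : F.length ≤ j := by simpa using hj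
    obtain ⟨b, rfl, hb⟩ := ih (j + 1) (by omega) z fun g hg ↦ hz g (List.mem_cons_of_mem _ hg)
    obtain ⟨k, hk⟩ := hz f List.mem_cons_self
    rw [← map_smul] at hk
    obtain ⟨y, hy⟩ := (hex (j + 1) _).1 hk
    have hyF : IsPowTorsion F y := fun g hg ↦ by
      obtain ⟨n, hn⟩ := hb g hg
      refine ⟨n, hε _ ?_⟩
      rw [map_smul, hy, smul_comm, hn, smul_zero, map_zero]
    obtain ⟨a', rfl, ha'⟩ := ih j hj' y hyF
    obtain ⟨a, ha, p, hp⟩ := ha'.exists_pow_smul_sub f k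
    refine ⟨b - ε (j + 1) (π j a), ?_, ?_⟩
    · rw [map_sub, (hex (j + 1)).apply_apply_eq_zero, sub_zero]
    · intro g hg
      rcases List.mem_cons.1 hg with rfl | hg
      · refine ⟨p + k, ?_⟩
        rw [pow_add, mul_smul, smul_sub, ← hy, ← map_smul, ← map_smul, ← map_sub, ← map_sub,
          ← map_smul, ← map_smul, ← neg_sub, smul_neg, hp]
        simp
      · obtain ⟨n, hn⟩ := hb g hg
        obtain ⟨m, hm⟩ := ha g hg
        refine ⟨n + m, ?_⟩
        rw [smul_sub, ← map_smul, ← map_smul, pow_add, mul_smul _ _ a, hm, mul_comm, mul_smul, hn]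
        simp

/-- The cosyzygies of `M` for the chosen embeddings into injectives. -/
def cosyzygy (M : ModuleCat.{u} R) : ℕ → ModuleCat.{u} R
  | 0 => M
  | j + 1 => cokernel (Injective.ι (cosyzygy M j))

theorem cocyclesDie_of_radical_eq [IsNoetherianRing R] {I : Ideal R} (F : List R)
    (h : I.radical = (Ideal.span {f | f ∈ F}).radical) (M : ModuleCat.{u} R) :
    CocyclesDie I F.length M := by
  let Z := cosyzygy M
  let ε : ∀ j, Z j ⟶ Injective.under (Z j) := fun j ↦ Injective.ι _
  let π : ∀ j, Injective.under (Z j) ⟶ Z (j + 1) := fun j ↦ cokernel.π (Injective.ι (Z j))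
  have : ∀ j, Epi (π j) := fun j ↦ inferInstanceAs (Epi (cokernel.π (Injective.ι (Z j))))
  have hw : ∀ j, ε j ≫ π j = 0 := fun j ↦ cokernel.condition _
  have hex : ∀ j, (ShortComplex.mk (ε j) (π j) (hw j)).Exact := fun j ↦
    ShortComplex.exact_cokernel _
  have hinj : ∀ j, Module.Injective R (Injective.under (Z j) : ModuleCat R) := fun j ↦
    Module.injective_module_of_injective_object (inj := Injective.injective_under (Z j)) R _
  suffices H : ∀ i j, i + j = F.length → CocyclesDie I i (Z j) from H _ 0 (add_zero _)
  intro i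
  induction i with
  | zero =>
    intro j hj
    refine CocyclesDie.zero (ε j) (π j) (hw j) (hex j) fun z k hz ↦ ?_
    obtain ⟨e, he, heF⟩ := IsPowTorsion.exists_lift (fun j ↦ (ε j).hom) (fun j ↦ (π j).hom)
      (fun j ↦ (ModuleCat.mono_iff_injective (ε j)).1 inferInstance)
      (fun j ↦ (ModuleCat.epi_iff_surjective (π j)).1 inferInstance)
      (fun j ↦ (ShortComplex.ShortExact.moduleCat_exact_iff_function_exact _).1 (hex j))
      F j (by omega) z (fun f hf ↦ by
        have hf' : f ∈ I.radical := by
          rw [h]; exact Ideal.le_radical (Ideal.subset_span hf)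
        obtain ⟨s, hs⟩ := hf'
        exact ⟨s * k, hz _ (by rw [pow_mul]; exact Ideal.pow_mem_pow hs k)⟩)
    refine ⟨e, he, ?_⟩
    let 𝔟 : Ideal R := LinearMap.ker (LinearMap.toSpanSingleton R _ e)
    have h𝔟 : I ≤ 𝔟.radical := by
      refine Ideal.le_radical.trans (h.le.trans ((Ideal.radical_le_radical_iff).2
        (Ideal.span_le.2 fun f hf ↦ ?_)))
      obtain ⟨n, hn⟩ := heF f hf
      exact ⟨n, LinearMap.mem_ker.2 hn⟩
    obtain ⟨m, hm⟩ := Ideal.exists_pow_le_of_le_radical_of_fg h𝔟 (IsNoetherian.noetherian I)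
    exact ⟨m, fun r hr ↦ LinearMap.mem_ker.1 (hm hr)⟩
  | succ i ih =>
    intro j hj
    exact (ih (j + 1) (by omega)).succ (ε j) (π j) (hw j) (hex j)

/-- Local cohomology vanishes above the number of generators of the ideal up to radical. -/
theorem subsingleton_localCohomology_of_radical_eq {R : Type} [CommRing R] [IsNoetherianRing R]
    {I : Ideal R} (F : List R) (h : I.radical = (Ideal.span {f | f ∈ F}).radical)
    (M : ModuleCat.{0} R) : Subsingleton ((localCohomology I (F.length + 1)).obj M) :=
  (cocyclesDie_of_radical_eq F h M).subsingleton_localCohomology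

end LocalCohomology

section Avoidance

/-- In a noetherian ring, the primes that contain `J` but not `K` all lie over
finitely many such primes. -/
theorem exists_finset_primes_not_le {B : Type*} [CommRing B] [IsNoetherianRing B]
    (J K : Ideal B) :
    ∃ s : Finset (Ideal B), (∀ P ∈ s, P.IsPrime ∧ J ≤ P ∧ ¬ K ≤ P) ∧
      ∀ P : Ideal B, P.IsPrime → J ≤ P → ¬ K ≤ P → ∃ P₀ ∈ s, P₀ ≤ P := by
  classical
  refine ⟨(Ideal.finite_minimalPrimes_of_isNoetherianRing B J).toFinset.filter (¬ K ≤ ·),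
    fun P hP ↦ ?_, fun P hP hJ hK ↦ ?_⟩
  · rw [Finset.mem_filter, Set.Finite.mem_toFinset] at hP
    exact ⟨hP.1.1.1, hP.1.1.2, hP.2⟩
  · obtain ⟨P₀, h₀, hle⟩ := Ideal.exists_minimalPrimes_le hJ
    refine ⟨P₀, ?_, hle⟩
    rw [Finset.mem_filter, Set.Finite.mem_toFinset]
    exact ⟨h₀, fun h ↦ hK (h.trans hle)⟩

variable {R T : Type*} [CommRing R] [CommRing T] [Algebra R T]
  (𝒜 : ℤ → Submodule R T) [GradedAlgebra 𝒜]

/-- Homogeneous prime avoidance in positive degrees. -/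
theorem exists_mem_graded_notMem (s : Finset (Ideal T))
    (hs : ∀ P ∈ s, P.IsPrime ∧ ∃ κ ∈ 𝒜 1, κ ∉ P) :
    ∃ e : ℕ, 1 ≤ e ∧ ∃ y ∈ 𝒜 (e : ℤ), ∀ P ∈ s, y ∉ P := by
  classical
  induction s using Finset.strongInduction with
  | H s ih =>
  rcases s.eq_empty_or_nonempty with rfl | hne
  · exact ⟨1, le_rfl, 0, Submodule.zero_mem _, by simp⟩
  obtain ⟨P, hP, hmin⟩ := Finset.exists_minimalFor
    (fun P : Ideal T ↦ (P.homogeneousCore 𝒜).toIdeal) s hne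
  obtain ⟨e, he, y, hy, hys⟩ := ih (s.erase P) (Finset.erase_ssubset hP)
    fun Q hQ ↦ hs Q (Finset.mem_of_mem_erase hQ)
  by_cases hyP : y ∉ P
  · refine ⟨e, he, y, hy, fun Q hQ ↦ ?_⟩
    by_cases hQP : Q = P
    · exact hQP ▸ hyP
    · exact hys Q (Finset.mem_erase.mpr ⟨hQP, hQ⟩)
  rw [not_not] at hyP
  have := (hs P hP).1
  have hw : ∀ Q ∈ s.erase P, ∃ (i : ℤ) (w : T), w ∈ 𝒜 i ∧ w ∈ Q ∧ w ∉ P := by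
    intro Q hQ
    by_contra! hcon
    have hle : (Q.homogeneousCore 𝒜).toIdeal ≤ (P.homogeneousCore 𝒜).toIdeal := by
      refine Ideal.span_le.mpr ?_
      rintro _ ⟨⟨x, i, hx⟩, hxQ, rfl⟩
      exact Ideal.mem_homogeneousCore_of_homogeneous_of_mem ⟨i, hx⟩ (hcon i x hx hxQ)
    have h2 := hmin (Finset.mem_of_mem_erase hQ) hle
    exact hys Q hQ (Ideal.toIdeal_homogeneousCore_le 𝒜 Q
      (h2 (Ideal.mem_homogeneousCore_of_homogeneous_of_mem ⟨_, hy⟩ hyP)))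
  choose! i w hwi hwQ hwP using hw
  obtain ⟨κ, hκ, hκP⟩ := (hs P hP).2
  set D := ∑ Q ∈ s.erase P, i Q
  set N := (|D| + 1).toNat
  have hN : (N : ℤ) = |D| + 1 := Int.toNat_of_nonneg (by positivity)
  obtain ⟨E, hE⟩ : ∃ E : ℕ, (E : ℤ) = D + N :=
    ⟨(D + N).toNat, Int.toNat_of_nonneg (by have := neg_abs_le D; omega)⟩
  have hE1 : 1 ≤ E := by have := neg_abs_le D; omega
  set W := (∏ Q ∈ s.erase P, w Q) * κ ^ N
  have hW : W ∈ 𝒜 (E : ℤ) := by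
    have h1 := SetLike.mul_mem_graded (SetLike.prod_mem_graded 𝒜 i w hwi)
      (SetLike.pow_mem_graded N hκ)
    rwa [nsmul_eq_mul, mul_one, ← hE] at h1
  have hWP : W ∉ P := by
    intro h
    rcases (hs P hP).1.mem_or_mem h with h | h
    · obtain ⟨Q, hQ, hQP⟩ := (Ideal.IsPrime.prod_mem_iff).mp h
      exact hwP Q hQ hQP
    · exact hκP ((hs P hP).1.mem_of_pow_mem _ h)
  have hWQ : ∀ Q ∈ s.erase P, W ∈ Q := fun Q hQ ↦
    Ideal.mul_mem_right _ _ (Ideal.mem_of_dvd _ (Finset.dvd_prod_of_mem w hQ) (hwQ Q hQ))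
  refine ⟨e * E, Nat.mul_pos he hE1, y ^ E + W ^ e, ?_, fun Q hQ h ↦ ?_⟩
  · refine Submodule.add_mem _ ?_ ?_
    · have := SetLike.pow_mem_graded E hy
      rwa [nsmul_eq_mul, mul_comm, ← Nat.cast_mul] at this
    · have := SetLike.pow_mem_graded e hW
      rwa [nsmul_eq_mul, ← Nat.cast_mul] at this
  · by_cases hQP : Q = P
    · subst hQP
      exact hWP (this.mem_of_pow_mem _
        ((Ideal.add_mem_iff_right _ (Ideal.pow_mem_of_mem _ hyP _ hE1)).mp h))
    · have hQ' := Finset.mem_erase.mpr ⟨hQP, hQ⟩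
      exact hys Q hQ' ((hs Q hQ).1.mem_of_pow_mem _
        ((Ideal.add_mem_iff_left _ (Ideal.pow_mem_of_mem _ (hWQ Q hQ') _ he)).mp h))

/-- There are homogeneous elements of positive degree such that the primes not containing `K`
and containing `h` of them have height at least `h`, or `h + 1` if they contain the
non-zero-divisor `u`. -/
theorem exists_graded_height_le [IsNoetherianRing T] {u : T} (hu : u ∈ nonZeroDivisors T)
    (K : Ideal T) (hK : ∀ P : Ideal T, P.IsPrime → ¬ K ≤ P → ∃ κ ∈ 𝒜 1, κ ∉ P) :
    ∃ y : ℕ → T, (∀ h, ∃ e : ℕ, 1 ≤ e ∧ y h ∈ 𝒜 (e : ℤ)) ∧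
      ∀ (h : ℕ) (P : Ideal T), P.IsPrime → ¬ K ≤ P → (∀ i < h, y i ∈ P) →
        (h : ℕ∞) ≤ P.height ∧ (u ∈ P → (h : ℕ∞) + 1 ≤ P.height) := by
  classical
  have key : ∀ J : Ideal T, ∃ y : T, (∃ e : ℕ, 1 ≤ e ∧ y ∈ 𝒜 (e : ℤ)) ∧
      (∀ P : Ideal T, P.IsPrime → ¬ K ≤ P → J ≤ P → y ∈ P →
        ∃ Q : Ideal T, Q.IsPrime ∧ ¬ K ≤ Q ∧ J ≤ Q ∧ Q < P ∧ (u ∈ P → ∃ Q' : Ideal T,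
          Q'.IsPrime ∧ ¬ K ≤ Q' ∧ J ≤ Q' ∧ Q' < P ∧ u ∈ Q')) := by
    intro J
    obtain ⟨s₁, hs₁, hs₁'⟩ := exists_finset_primes_not_le J K
    obtain ⟨s₂, hs₂, hs₂'⟩ := exists_finset_primes_not_le (J ⊔ Ideal.span {u}) K
    obtain ⟨e, he, y, hy, hys⟩ := exists_mem_graded_notMem 𝒜 (s₁ ∪ s₂) (by
      intro P hP
      rcases Finset.mem_union.mp hP with h | h
      · exact ⟨(hs₁ P h).1, hK P (hs₁ P h).1 (hs₁ P h).2.2⟩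
      · exact ⟨(hs₂ P h).1, hK P (hs₂ P h).1 (hs₂ P h).2.2⟩)
    refine ⟨y, ⟨e, he, hy⟩, fun P hP hKP hJP hyP ↦ ?_⟩
    obtain ⟨Q, hQ, hQP⟩ := hs₁' P hP hJP hKP
    refine ⟨Q, (hs₁ Q hQ).1, (hs₁ Q hQ).2.2, (hs₁ Q hQ).2.1, lt_of_le_of_ne hQP ?_, fun huP ↦ ?_⟩
    · rintro rfl
      exact hys Q (Finset.mem_union_left _ hQ) hyP
    obtain ⟨Q', hQ', hQP'⟩ := hs₂' P hP
      (sup_le hJP ((Ideal.span_singleton_le_iff_mem P).mpr huP)) hKP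
    have hle := (hs₂ Q' hQ').2.1
    refine ⟨Q', (hs₂ Q' hQ').1, (hs₂ Q' hQ').2.2, le_sup_left.trans hle,
      lt_of_le_of_ne hQP' ?_, hle (Ideal.mem_sup_right (Ideal.mem_span_singleton_self u))⟩
    rintro rfl
    exact hys Q' (Finset.mem_union_right _ hQ') hyP
  choose g hg hg' using key
  let J : ℕ → Ideal T := fun n ↦ Nat.rec ⊥ (fun _ I ↦ I ⊔ Ideal.span {g I}) n
  have hJ : ∀ h (P : Ideal T), (∀ i < h, g (J i) ∈ P) → J h ≤ P := by
    intro h P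
    induction h with
    | zero => exact fun _ ↦ bot_le
    | succ h ih =>
      exact fun H ↦ sup_le (ih fun i hi ↦ H i (hi.trans h.lt_succ_self))
        ((Ideal.span_singleton_le_iff_mem P).mpr (H h h.lt_succ_self))
  have hJ' : ∀ h (P : Ideal T), J h ≤ P → ∀ i < h, g (J i) ∈ P := by
    intro h P
    induction h with
    | zero => exact fun _ i hi ↦ absurd hi (Nat.not_lt_zero i)
    | succ h ih =>
      intro H i hi
      rcases Nat.lt_succ_iff_lt_or_eq.mp hi with hi | rfl
      · exact ih (le_sup_left.trans H) i hi
      · exact H (Ideal.mem_sup_right (Ideal.mem_span_singleton_self _))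
  refine ⟨fun h ↦ g (J h), fun h ↦ hg (J h), fun h ↦ ?_⟩
  induction h with
  | zero =>
    refine fun P hP _ _ ↦ ⟨by simp, fun huP ↦ ?_⟩
    simpa using (Ideal.one_le_height_span_singleton_of_mem_nonZeroDivisors hu).trans
      (Ideal.height_mono ((Ideal.span_singleton_le_iff_mem P).mpr huP))
  | succ h ih =>
    intro P hP hKP hyP
    obtain ⟨Q, hQ, hKQ, hJQ, hQP, hQu⟩ := hg' (J h) P hP hKP
      (hJ h P fun i hi ↦ hyP i (hi.trans h.lt_succ_self)) (hyP h h.lt_succ_self)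
    refine ⟨?_, fun huP ↦ ?_⟩
    · rw [Nat.cast_add, Nat.cast_one]
      exact (add_le_add_left (ih Q hQ hKQ (hJ' h Q hJQ)).1 1).trans
        (Ideal.height_add_one_le_of_lt_of_isPrime hQP)
    · obtain ⟨Q', hQ', hKQ', hJQ', hQP', huQ'⟩ := hQu huP
      rw [Nat.cast_add, Nat.cast_one]
      exact (add_le_add_left ((ih Q' hQ' hKQ' (hJ' h Q' hJQ')).2 huQ') 1).trans
        (Ideal.height_add_one_le_of_lt_of_isPrime hQP')

/-- If the primes over `𝔞 + 𝔠 h` have height greater than `h`, then there are `z h ∈ 𝔠 (h + 1) ∩ 𝔪`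
such that the primes over `𝔞 + (z i | i < h)` other than `𝔪` have height greater than `h`. -/
theorem exists_forall_mem_height_le {A : Type*} [CommRing A] [IsNoetherianRing A] [IsLocalRing A]
    (𝔞 : Ideal A) (h𝔞 : ∀ q : Ideal A, q.IsPrime → 𝔞 ≤ q → 1 ≤ q.height)
    (𝔠 : ℕ → Ideal A)
    (h𝔠 : ∀ (h : ℕ) (q : Ideal A), q.IsPrime → 𝔞 ≤ q → 𝔠 h ≤ q → (h : ℕ∞) + 1 ≤ q.height) :
    ∃ z : ℕ → A, (∀ h, z h ∈ 𝔠 (h + 1) ∧ z h ∈ IsLocalRing.maximalIdeal A) ∧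
      ∀ (h : ℕ) (q : Ideal A), q.IsPrime → 𝔞 ≤ q → (∀ i < h, z i ∈ q) →
        q = IsLocalRing.maximalIdeal A ∨ (h : ℕ∞) + 1 ≤ q.height := by
  classical
  have key : ∀ (J K : Ideal A), ∃ z ∈ K, ∀ q : Ideal A, q.IsPrime → J ≤ q → z ∈ q →
      ∃ p : Ideal A, p.IsPrime ∧ J ≤ p ∧ (K ≤ p ∧ p ≤ q ∨ p < q) := by
    intro J K
    obtain ⟨s, hs, hs'⟩ := exists_finset_primes_not_le J K
    have hsub : ¬ ((K : Set A) ⊆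
        ⋃ i ∈ (↑s : Set (Ideal A)), ((fun P : Ideal A ↦ P) i : Set A)) := by
      rw [Ideal.subset_union_prime (f := fun P : Ideal A ↦ P) ⊥ ⊥ (fun i hi _ _ ↦ (hs i hi).1)]
      rintro ⟨i, hi, hKi⟩
      exact (hs i hi).2.2 hKi
    obtain ⟨z, hzK, hz⟩ := Set.not_subset.mp hsub
    refine ⟨z, hzK, fun q hq hJq hzq ↦ ?_⟩
    by_cases hKq : K ≤ q
    · exact ⟨q, hq, hJq, Or.inl ⟨hKq, le_rfl⟩⟩
    obtain ⟨p, hp, hpq⟩ := hs' q hq hJq hKq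
    refine ⟨p, (hs p hp).1, (hs p hp).2.1, Or.inr (lt_of_le_of_ne hpq ?_)⟩
    rintro rfl
    exact hz (Set.mem_biUnion (Finset.mem_coe.mpr hp) hzq)
  choose g hgK hg using key
  let b : ℕ → Ideal A := fun n ↦ Nat.rec 𝔞
    (fun h J ↦ J ⊔ Ideal.span {g J (𝔠 (h + 1) ⊓ IsLocalRing.maximalIdeal A)}) n
  let z : ℕ → A := fun h ↦ g (b h) (𝔠 (h + 1) ⊓ IsLocalRing.maximalIdeal A)
  have hb : ∀ h (q : Ideal A), 𝔞 ≤ q → (∀ i < h, z i ∈ q) → b h ≤ q := by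
    intro h q hq
    induction h with
    | zero => exact fun _ ↦ hq
    | succ h ih =>
      exact fun H ↦ sup_le (ih fun i hi ↦ H i (hi.trans h.lt_succ_self))
        ((Ideal.span_singleton_le_iff_mem q).mpr (H h h.lt_succ_self))
  have hb' : ∀ h (q : Ideal A), b h ≤ q → 𝔞 ≤ q ∧ ∀ i < h, z i ∈ q := by
    intro h q
    induction h with
    | zero => exact fun H ↦ ⟨H, fun i hi ↦ absurd hi (Nat.not_lt_zero i)⟩
    | succ h ih =>
      intro H
      obtain ⟨h1, h2⟩ := ih (le_sup_left.trans H)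
      refine ⟨h1, fun i hi ↦ ?_⟩
      rcases Nat.lt_succ_iff_lt_or_eq.mp hi with hi | rfl
      · exact h2 i hi
      · exact H (Ideal.mem_sup_right (Ideal.mem_span_singleton_self _))
  refine ⟨z, fun h ↦ hgK (b h) (𝔠 (h + 1) ⊓ IsLocalRing.maximalIdeal A), fun h ↦ ?_⟩
  induction h with
  | zero =>
    intro q hq h𝔞q _
    right
    simpa using h𝔞 q hq h𝔞q
  | succ h ih =>
    intro q hq h𝔞q hzq
    obtain ⟨p, hp, hbp, hpq⟩ := hg (b h) (𝔠 (h + 1) ⊓ IsLocalRing.maximalIdeal A) q hq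
      (hb h q h𝔞q fun i hi ↦ hzq i (hi.trans h.lt_succ_self)) (hzq h h.lt_succ_self)
    obtain ⟨h𝔞p, hzp⟩ := hb' h p hbp
    rcases hpq with ⟨hKp, hpq⟩ | hpq
    · rcases hp.inf_le.mp hKp with h1 | h1
      · exact Or.inr ((h𝔠 (h + 1) p hp h𝔞p h1).trans (Ideal.height_mono hpq))
      · exact Or.inl (le_antisymm (IsLocalRing.le_maximalIdeal hq.ne_top) (h1.trans hpq))
    · right
      have hp1 := (ih p hp h𝔞p hzp).resolve_left (by
        rintro rfl
        exact absurd (IsLocalRing.le_maximalIdeal hq.ne_top) hpq.not_ge)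
      rw [Nat.cast_add, Nat.cast_one]
      exact (add_le_add_left hp1 1).trans (Ideal.height_add_one_le_of_lt_of_isPrime hpq)

/-- Up to radical, the ideal generated by `𝔪` and the elements of positive degree can be generated
by `d = dim R` elements. -/
theorem exists_list_radical_eq [IsNoetherianRing R] [IsLocalRing R] [IsNoetherianRing T]
    {d : ℕ} (hd1 : 1 ≤ d) (hd : ringKrullDim R = d) (𝔞 : Ideal R) (h𝔞 : 𝔞 ≠ ⊤)
    (h𝔞1 : ∀ q : Ideal R, q.IsPrime → 𝔞 ≤ q → 1 ≤ q.height)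
    {u : T} (hu : u ∈ nonZeroDivisors T) (K : Ideal T)
    (hK1 : ∀ P : Ideal T, P.IsPrime → ¬ K ≤ P → ∃ κ ∈ 𝒜 1, κ ∉ P)
    (hK2 : ∀ e : ℕ, 1 ≤ e → ∀ y ∈ 𝒜 (e : ℤ), y ∈ K)
    (h𝔞K : 𝔞 ≤ K.comap (algebraMap R T))
    (hNV : ∀ q : Ideal R, q.IsPrime → 𝔞 ≤ q → ∃ N V : Ideal T, N.IsPrime ∧ V.IsPrime ∧ V < N ∧
      K ≤ V ∧ N.height ≤ q.height + 1 ∧ ∀ P : Ideal T, P.IsPrime → P.IsHomogeneous 𝒜 →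
        P.comap (algebraMap R T) ≤ q → P ≤ N ∧ (u ∉ P → P ≤ V)) :
    ∃ F : List T, F.length = d ∧
      ((IsLocalRing.maximalIdeal R).map (algebraMap R T) ⊔ K).radical =
        (Ideal.span {f | f ∈ F}).radical := by
  classical
  obtain ⟨y, hy, hyP⟩ := exists_graded_height_le 𝒜 hu K hK1
  choose s hs hs' using fun h : ℕ ↦
    exists_finset_primes_not_le (Ideal.span (y '' {i | i < h})) K
  have hyspan : ∀ (h : ℕ) (P : Ideal T), Ideal.span (y '' {i | i < h}) ≤ P ↔ ∀ i < h, y i ∈ P := by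
    intro h P
    simp [Ideal.span_le, Set.subset_def]
  let 𝔠 : ℕ → Ideal R := fun h ↦ (s h).inf fun P ↦ P.comap (algebraMap R T)
  have h𝔠 : ∀ (h : ℕ) (P : Ideal T), P.IsPrime → ¬ K ≤ P → (∀ i < h, y i ∈ P) →
      ∀ r ∈ 𝔠 h, algebraMap R T r ∈ P := by
    intro h P hP hKP hyP r hr
    obtain ⟨P₀, hP₀, hle⟩ := hs' h P hP ((hyspan h P).mpr hyP) hKP
    exact hle (Finset.inf_le (f := fun P : Ideal T ↦ P.comap (algebraMap R T)) hP₀ hr)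
  have h𝔠q : ∀ (h : ℕ) (q : Ideal R), q.IsPrime → 𝔞 ≤ q → 𝔠 h ≤ q →
      (h : ℕ∞) + 1 ≤ q.height := by
    intro h q hq h𝔞q hle
    obtain ⟨P₀, hP₀, hPq⟩ := (Ideal.IsPrime.inf_le' hq).mp hle
    obtain ⟨hP₀p, hP₀y, hP₀K⟩ := hs h P₀ hP₀
    have hPle := Ideal.toIdeal_homogeneousCore_le 𝒜 P₀
    have hPp := hP₀p.homogeneousCore (𝒜 := 𝒜)
    have hPK : ¬ K ≤ (P₀.homogeneousCore 𝒜).toIdeal := fun H ↦ hP₀K (H.trans hPle)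
    have hPy : ∀ i < h, y i ∈ (P₀.homogeneousCore 𝒜).toIdeal := fun i hi ↦ by
      obtain ⟨e, -, hye⟩ := hy i
      exact Ideal.mem_homogeneousCore_of_homogeneous_of_mem ⟨_, hye⟩
        ((hyspan h P₀).mp hP₀y i hi)
    obtain ⟨N, V, hN, hV, hVN, hKV, hNq, hPNV⟩ := hNV q hq h𝔞q
    obtain ⟨hPN, hPV⟩ := hPNV _ hPp (P₀.homogeneousCore 𝒜).isHomogeneous
      ((Ideal.comap_mono hPle).trans hPq)
    obtain ⟨hP1, hP2⟩ := hyP h _ hPp hPK hPy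
    have hN2 : (h : ℕ∞) + 1 + 1 ≤ N.height := by
      by_cases hu : u ∈ (P₀.homogeneousCore 𝒜).toIdeal
      · refine (add_le_add_left (hP2 hu) 1).trans
          (Ideal.height_add_one_le_of_lt_of_isPrime (lt_of_le_of_ne hPN ?_))
        intro H
        exact hPK (H ▸ hKV.trans hVN.le)
      · have hlt : (P₀.homogeneousCore 𝒜).toIdeal < V :=
          lt_of_le_of_ne (hPV hu) fun H ↦ hPK (H ▸ hKV)
        refine (add_le_add_left ?_ 1).trans (Ideal.height_add_one_le_of_lt_of_isPrime hVN)
        exact (add_le_add_left hP1 1).trans (Ideal.height_add_one_le_of_lt_of_isPrime hlt)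
    exact (ENat.add_le_add_iff_right ENat.one_ne_top).mp (hN2.trans hNq)
  obtain ⟨z, hz, hzq⟩ := exists_forall_mem_height_le 𝔞 h𝔞1 𝔠 h𝔠q
  have hmax : (IsLocalRing.maximalIdeal R).height = d := by
    have := IsLocalRing.maximalIdeal_height_eq_ringKrullDim (R := R)
    rw [hd] at this
    exact_mod_cast this
  let w : ℕ → R := fun i ↦ Nat.casesOn i 0 z
  have hw𝔪 : ∀ i, w i ∈ IsLocalRing.maximalIdeal R := by
    rintro (_ | i)
    · exact Ideal.zero_mem _
    · exact (hz i).2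
  have hw𝔠 : ∀ i, w i ∈ 𝔠 i := by
    rintro (_ | i)
    · exact Ideal.zero_mem _
    · exact (hz i).1
  have hyK : ∀ i, y i ∈ K := fun i ↦ by
    obtain ⟨e, he, hye⟩ := hy i
    exact hK2 e he _ hye
  refine ⟨(List.range d).map fun i ↦ y i + algebraMap R T (w i), by simp, ?_⟩
  apply le_antisymm
  · rw [Ideal.radical_le_radical_iff, Ideal.radical_eq_sInf, le_sInf_iff]
    rintro Q ⟨hQF, hQ⟩
    have hQi : ∀ i < d, y i + algebraMap R T (w i) ∈ Q := fun i hi ↦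
      hQF (Ideal.subset_span (List.mem_map.mpr ⟨i, List.mem_range.mpr hi, rfl⟩))
    have hKQ : K ≤ Q := by
      by_contra hKQ
      have hyQ : ∀ i < d, y i ∈ Q := by
        intro i
        induction i using Nat.strong_induction_on with
        | _ i ih =>
        intro hi
        exact (Ideal.add_mem_iff_left _ (h𝔠 i Q hQ hKQ
          (fun j hj ↦ ih j hj (hj.trans hi)) _ (hw𝔠 i))).mp (hQi i hi)
      have htop : 𝔠 d = ⊤ := by
        by_contra hne
        have h1 := h𝔠q d _ (IsLocalRing.maximalIdeal.isMaximal R).isPrime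
          (IsLocalRing.le_maximalIdeal h𝔞) (IsLocalRing.le_maximalIdeal hne)
        rw [hmax] at h1
        exact absurd h1 (by exact_mod_cast Nat.not_succ_le_self d)
      apply hQ.ne_top
      rw [Ideal.eq_top_iff_one, ← map_one (algebraMap R T)]
      exact h𝔠 d Q hQ hKQ hyQ 1 (htop ▸ Submodule.mem_top)
    refine sup_le ?_ hKQ
    rw [Ideal.map_le_iff_le_comap]
    have hzQ : ∀ i < d - 1, z i ∈ Q.comap (algebraMap R T) := fun i hi ↦ by
      have := hQi (i + 1) (by omega)
      exact (Ideal.add_mem_iff_right _ (hKQ (hyK _))).mp this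
    rcases hzq (d - 1) (Q.comap (algebraMap R T)) (hQ.comap _)
      (h𝔞K.trans (Ideal.comap_mono hKQ)) hzQ with h | h
    · exact h.ge
    · have h2 : ((d - 1 : ℕ) : ℕ∞) + 1 = d := by
        exact_mod_cast Nat.sub_add_cancel hd1
      rw [h2] at h
      have := hQ.comap (algebraMap R T)
      exact (Ideal.eq_of_le_of_height_le _ (IsLocalRing.le_maximalIdeal this.ne_top)
        (hmax.trans_le h)).ge
  · refine Ideal.radical_mono (Ideal.span_le.mpr ?_)
    intro f hf
    obtain ⟨i, -, rfl⟩ := List.mem_map.mp hf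
    exact add_mem (Ideal.mem_sup_right (hyK i))
      (Ideal.mem_sup_left (Ideal.mem_map_of_mem _ (hw𝔪 i)))

end Avoidance

section HeightBound

/-- Heights of primes do not decrease on taking preimages under a surjection. -/
theorem height_le_height_comap_of_surjective {A B : Type*} [CommRing A] [CommRing B] {ψ : A →+* B}
    (hψ : Function.Surjective ψ) (Q : Ideal B) [hQ : Q.IsPrime] :
    Q.height ≤ (Q.comap ψ).height := by
  have hmono : StrictMono (PrimeSpectrum.comap ψ) := fun P P' h ↦
    lt_of_le_of_ne (Ideal.comap_mono h.le)
      fun H ↦ h.ne (PrimeSpectrum.comap_injective_of_surjective ψ hψ H)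
  simpa only [← PrimeSpectrum.height_eq_orderHeight, PrimeSpectrum.comap_asIdeal] using
    Order.height_le_height_apply_of_strictMono _ hmono ⟨Q, hQ⟩

/-- If the kernel of a surjective ring homomorphism contains a non-zero-divisor, then
heights of primes increase by at least one on taking preimages. -/
theorem height_add_one_le_height_comap {A B : Type*} [CommRing A] [CommRing B] {ψ : A →+* B}
    (hψ : Function.Surjective ψ) {f : A} (hf : f ∈ nonZeroDivisors A) (hf0 : ψ f = 0)
    (Q : Ideal B) [Q.IsPrime] : Q.height + 1 ≤ (Q.comap ψ).height := by
  have key : ∀ (n : ℕ) (Q : Ideal B), Q.IsPrime → (n : ℕ∞) ≤ Q.height →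
      (n : ℕ∞) + 1 ≤ (Q.comap ψ).height := by
    intro n
    induction n with
    | zero =>
      intro Q _ _
      have hfQ : f ∈ Q.comap ψ := by rw [Ideal.mem_comap, hf0]; exact Q.zero_mem
      simpa using (Ideal.one_le_height_span_singleton_of_mem_nonZeroDivisors hf).trans
        (Ideal.height_mono ((Ideal.span_singleton_le_iff_mem _).mpr hfQ))
    | succ n ih =>
      intro Q hQ hn
      have hlt : ¬ Q.height ≤ n := fun h ↦
        absurd (hn.trans h) (by exact_mod_cast Nat.not_succ_le_self n)
      rw [Ideal.height_le_iff] at hlt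
      push Not at hlt
      obtain ⟨P, hP, hPQ, hnP⟩ := hlt
      have hcomap : P.comap ψ < Q.comap ψ := by
        refine lt_of_le_of_ne (Ideal.comap_mono hPQ.le) fun h ↦ hPQ.ne ?_
        exact Ideal.comap_injective_of_surjective ψ hψ h
      rw [Nat.cast_add, Nat.cast_one]
      exact (add_le_add_left (ih P hP hnP) 1).trans
        (Ideal.height_add_one_le_of_lt_of_isPrime hcomap)
  refine ENat.forall_natCast_le_iff_le.mp fun m hm ↦ ?_
  rcases m with _ | m
  · simp
  · have hm' : (m : ℕ∞) ≤ Q.height := by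
      rw [Nat.cast_add, Nat.cast_one] at hm
      exact (ENat.add_le_add_iff_right ENat.one_ne_top).mp hm
    exact_mod_cast key m Q inferInstance hm'

open Polynomial in
attribute [local instance] Polynomial.algebra Polynomial.isLocalization in
/-- The height of a prime of a polynomial ring in one variable exceeds the height of its
contraction by at most one. -/
theorem Polynomial.height_le_height_comap_C_add_one {B : Type*} [CommRing B] [IsNoetherianRing B]
    (Q : Ideal B[X]) [hQ : Q.IsPrime] : Q.height ≤ (Q.comap (C : B →+* B[X])).height + 1 := by
  set p := Q.comap (C : B →+* B[X]) with hp
  have : p.IsPrime := hQ.comap _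
  have : Q.LiesOver p := ⟨rfl⟩
  let Bₚ := Localization.AtPrime p
  set p' : Ideal Bₚ := p.map (algebraMap B Bₚ) with p'_def
  have hmax : p'.IsMaximal := by
    rw [p'_def, Localization.AtPrime.map_eq_maximalIdeal]
    exact IsLocalRing.maximalIdeal.isMaximal Bₚ
  let Q' : Ideal Bₚ[X] := Q.map (algebraMap B[X] Bₚ[X])
  have disj : Disjoint (p.primeCompl.map (C : B →+* B[X]) : Set B[X]) Q := by
    refine Set.disjoint_left.mpr fun a ⟨b, hb⟩ ha ↦ hb.1 ?_
    rw [SetLike.mem_coe, hp, Ideal.mem_comap, hb.2]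
    exact ha
  have hQ' : Q'.IsPrime := IsLocalization.isPrime_of_isPrime_disjoint
    (p.primeCompl.map (C : B →+* B[X])) _ Q hQ disj
  have : Q'.LiesOver p' := IsLocalization.liesOver_of_isPrime_of_disjoint p.primeCompl _ _ disj
  obtain ⟨M, hM, hQM⟩ := Ideal.exists_le_maximal Q' hQ'.ne_top
  have : M.LiesOver p' := ⟨hmax.eq_of_le (Ideal.IsPrime.ne_top inferInstance)
    ((Q'.over_def p').le.trans (Ideal.comap_mono hQM))⟩
  have eq1 : p.height = p'.height := by
    rw [IsLocalization.height_map_of_disjoint p.primeCompl]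
    exact Disjoint.symm <| Set.disjoint_left.mpr fun _ a b ↦ b a
  have eq2 : Q.height = Q'.height := by
    rw [IsLocalization.height_map_of_disjoint (p.primeCompl.map (C : B →+* B[X])) _ disj]
  rw [eq1, eq2, ← Polynomial.height_eq_height_add_one p' M]
  exact Ideal.height_mono hQM

/-- If each `x ∈ s` satisfies `u * x ∈ R` for a non-zero-divisor `u`, then heights of
primes of `R[u, s]` exceed the heights of their contractions to `R` by at most one. -/
theorem height_adjoin_insert_le {R A : Type*} [CommRing R] [IsNoetherianRing R] [CommRing A]
    [Algebra R A] {u : A} (hu : u ∈ nonZeroDivisors A) (s : Finset A)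
    (hs : ∀ x ∈ s, ∃ r : R, u * x = algebraMap R A r)
    (Q : Ideal (Algebra.adjoin R (insert u (s : Set A)))) [Q.IsPrime] :
    Q.height ≤ (Q.comap (algebraMap R _)).height + 1 := by
  classical
  induction s using Finset.induction with
  | empty =>
    have hmem : ∀ p : Polynomial R, Polynomial.aeval u p ∈
        Algebra.adjoin R (insert u ((∅ : Finset A) : Set A)) := fun p ↦ by simp
    let ψ : Polynomial R →+* Algebra.adjoin R (insert u ((∅ : Finset A) : Set A)) :=
      ((Polynomial.aeval u : Polynomial R →ₐ[R] A).codRestrict _ hmem).toRingHom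
    have hψ : Function.Surjective ψ := by
      rintro ⟨y, hy⟩
      have hy' : y ∈ Algebra.adjoin R {u} := by simpa using hy
      rw [Algebra.adjoin_singleton_eq_range_aeval] at hy'
      obtain ⟨p, rfl⟩ := hy'
      exact ⟨p, rfl⟩
    refine (height_le_height_comap_of_surjective hψ Q).trans
      ((Polynomial.height_le_height_comap_C_add_one _).trans (le_of_eq ?_))
    rw [Ideal.comap_comap]
    congr 3
    ext r
    simp [ψ]
  | insert x s hx ih =>
    set S := Algebra.adjoin R (insert u (s : Set A)) with hS
    have hS' : Algebra.adjoin R (insert u ((insert x s : Finset A) : Set A)) =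
        (Algebra.adjoin S {x}).restrictScalars R := by
      rw [hS, ← Algebra.adjoin_union_eq_adjoin_adjoin]
      congr 1
      ext y
      simp only [Finset.coe_insert, Set.mem_insert_iff, Set.mem_union, Set.mem_singleton_iff]
      tauto
    have : IsNoetherianRing S := isNoetherianRing_of_fg
      (Subalgebra.fg_def.mpr ⟨_, s.finite_toSet.insert u, rfl⟩)
    have hmem : ∀ p : Polynomial S, Polynomial.aeval x p ∈
        Algebra.adjoin R (insert u ((insert x s : Finset A) : Set A)) := fun p ↦ by
      rw [hS', Subalgebra.mem_restrictScalars]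
      exact Polynomial.aeval_mem_adjoin_singleton S x
    let ψ : Polynomial S →+* Algebra.adjoin R (insert u ((insert x s : Finset A) : Set A)) :=
      (Polynomial.aeval x : Polynomial S →ₐ[S] A).toRingHom.codRestrict
        (Algebra.adjoin R (insert u ((insert x s : Finset A) : Set A))).toSubring hmem
    have hψ : Function.Surjective ψ := by
      rintro ⟨y, hy⟩
      have hy' : y ∈ Algebra.adjoin S {x} := by rwa [hS', Subalgebra.mem_restrictScalars] at hy
      rw [Algebra.adjoin_singleton_eq_range_aeval] at hy'
      obtain ⟨p, rfl⟩ := hy'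
      exact ⟨p, rfl⟩
    obtain ⟨r, hr⟩ := hs x (Finset.mem_insert_self x s)
    have huS : u ∈ S := Algebra.subset_adjoin (Set.mem_insert u _)
    have huS' : (⟨u, huS⟩ : S) ∈ nonZeroDivisors S := by
      rw [mem_nonZeroDivisors_iff_right]
      intro z hz
      exact Subtype.ext ((mem_nonZeroDivisors_iff_right.mp hu) z (congrArg Subtype.val hz))
    set f : Polynomial S :=
      Polynomial.C ⟨u, huS⟩ * Polynomial.X - Polynomial.C (algebraMap R S r) with f_def
    have hf : f ∈ nonZeroDivisors (Polynomial S) := by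
      rcases subsingleton_or_nontrivial S with h | h
      · exact mem_nonZeroDivisors_iff_right.mpr fun z _ ↦ Subsingleton.elim _ _
      apply Polynomial.mem_nonZeroDivisors_of_leadingCoeff
      rwa [f_def, sub_eq_add_neg, ← Polynomial.C_neg,
        Polynomial.leadingCoeff_linear (nonZeroDivisors.ne_zero huS')]
    have hf0 : ψ f = 0 := by
      apply Subtype.ext
      change Polynomial.aeval x f = 0
      simp [f, hr]
    have h1 := height_add_one_le_height_comap hψ hf hf0 Q
    have h2 := (h1.trans (Polynomial.height_le_height_comap_C_add_one _))
    rw [ENat.add_le_add_iff_right ENat.one_ne_top] at h2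
    refine h2.trans ((ih (fun y hy ↦ hs y (Finset.mem_insert_of_mem hy)) _).trans (le_of_eq ?_))
    rw [Ideal.comap_comap, Ideal.comap_comap]
    congr 3
    ext r
    simp [ψ]

end HeightBound

section ExtendedRees

variable {R : Type*} [CommRing R]

/-- The extended Rees algebra of `𝔞`, as the Laurent polynomials whose `n`-th coefficient lies in
`𝔞 ^ n`, where `𝔞 ^ n = R` for `n ≤ 0`. -/
def extendedRees (𝔞 : Ideal R) : Subalgebra R (LaurentPolynomial R) where
  carrier := {f | ∀ n, f.coeff n ∈ 𝔞 ^ n.toNat}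
  mul_mem' {f g} hf hg n := by
    classical
    rw [AddMonoidAlgebra.coeff_mul]
    refine Ideal.sum_mem _ fun i _ ↦ Ideal.sum_mem _ fun j _ ↦ ?_
    dsimp only
    split_ifs with h
    · have := Ideal.mul_mem_mul (hf i) (hg j)
      rw [← pow_add] at this
      exact Ideal.pow_le_pow_right (by omega) this
    · exact Ideal.zero_mem _
  add_mem' {f g} hf hg n := by
    rw [AddMonoidAlgebra.coeff_add, Finsupp.add_apply]
    exact Ideal.add_mem _ (hf n) (hg n)
  algebraMap_mem' r n := by
    rw [← LaurentPolynomial.C_eq_algebraMap, LaurentPolynomial.C_apply]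
    split_ifs with h
    · simp [h]
    · exact Ideal.zero_mem _

namespace extendedRees

variable (𝔞 : Ideal R)

theorem single_mem {n : ℤ} {r : R} (hr : r ∈ 𝔞 ^ n.toNat) :
    (.single n r : LaurentPolynomial R) ∈ extendedRees 𝔞 := by
  classical
  intro m
  rw [AddMonoidAlgebra.coeff_single, Finsupp.single_apply]
  split_ifs with h
  · exact h ▸ hr
  · exact Ideal.zero_mem _

/-- The element `t⁻¹` of the extended Rees algebra. -/
noncomputable def tInv : extendedRees 𝔞 := ⟨.single (-1) 1, single_mem 𝔞 (by simp)⟩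

variable {𝔞} in
/-- The homogeneous component of degree `n` of an element of the extended Rees algebra. -/
noncomputable def component (f : extendedRees 𝔞) (n : ℤ) : extendedRees 𝔞 :=
  ⟨.single n (f.1.coeff n), single_mem 𝔞 (f.2 n)⟩

/-- The homogeneous elements of degree `n` of the extended Rees algebra. -/
def grading (n : ℤ) : Submodule R (extendedRees 𝔞) where
  carrier := {f | ∀ m ≠ n, f.1.coeff m = 0}
  add_mem' {f g} hf hg m hm := by
    change (f.1 + g.1).coeff m = 0
    rw [AddMonoidAlgebra.coeff_add, Finsupp.add_apply, hf m hm, hg m hm, add_zero]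
  zero_mem' _ _ := rfl
  smul_mem' r f hf m hm := by
    change (r • f.1).coeff m = 0
    rw [AddMonoidAlgebra.coeff_smul, Finsupp.smul_apply, hf m hm, smul_zero]

variable {𝔞}

theorem component_mem (f : extendedRees 𝔞) (n : ℤ) : component f n ∈ grading 𝔞 n :=
  fun _ hm ↦ Finsupp.single_eq_of_ne hm

theorem component_coeff_self (f : extendedRees 𝔞) (n : ℤ) :
    (component f n).1.coeff n = f.1.coeff n := Finsupp.single_eq_same

theorem ext_coeff {f g : extendedRees 𝔞} (h : ∀ n, f.1.coeff n = g.1.coeff n) : f = g :=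
  Subtype.ext (LaurentPolynomial.ext h)

theorem component_eq_self {f : extendedRees 𝔞} {n : ℤ} (hf : f ∈ grading 𝔞 n) :
    component f n = f := by
  refine ext_coeff fun m ↦ ?_
  by_cases hm : m = n
  · rw [hm, component_coeff_self]
  · rw [component_mem f n m hm, hf m hm]

open DirectSum in
theorem coeff_coeAddMonoidHom (x : ⨁ n, grading 𝔞 n) (m : ℤ) :
    (DirectSum.coeAddMonoidHom (grading 𝔞) x).1.coeff m = (x m).1.1.coeff m := by
  induction x using DirectSum.induction_on with
  | zero => rfl
  | of n y =>
    rw [DirectSum.coeAddMonoidHom_of]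
    by_cases hm : m = n
    · subst hm
      rw [DirectSum.of_eq_same]
    · rw [DirectSum.of_eq_of_ne _ _ _ hm, y.2 m hm]
      rfl
  | add x y hx hy =>
    rw [map_add, DirectSum.add_apply]
    change (_ + _ : LaurentPolynomial R).coeff m = (_ + _ : LaurentPolynomial R).coeff m
    rw [AddMonoidAlgebra.coeff_add, AddMonoidAlgebra.coeff_add, Finsupp.add_apply,
      Finsupp.add_apply, hx, hy]

open DirectSum in
/-- The decomposition of an element of the extended Rees algebra into its components. -/
noncomputable def decomposition (f : extendedRees 𝔞) : ⨁ n, grading 𝔞 n :=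
  DirectSum.mk (fun n ↦ grading 𝔞 n) f.1.coeff.support fun n ↦ ⟨component f n, component_mem f n⟩

theorem decomposition_apply (f : extendedRees 𝔞) (n : ℤ) :
    (decomposition f n : extendedRees 𝔞) = component f n := by
  by_cases hn : n ∈ f.1.coeff.support
  · rw [decomposition, DirectSum.mk_apply_of_mem hn]
  · rw [decomposition, DirectSum.mk_apply_of_notMem hn]
    refine (Subtype.ext ?_).symm
    change AddMonoidAlgebra.single n _ = 0
    rw [Finsupp.notMem_support_iff.mp hn, AddMonoidAlgebra.single_zero]

noncomputable instance : GradedAlgebra (grading 𝔞) where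
  one_mem m hm := by
    change (1 : LaurentPolynomial R).coeff m = 0
    rw [← map_one LaurentPolynomial.C, LaurentPolynomial.C_apply, if_neg hm]
  mul_mem i j f g hf hg m hm := by
    classical
    change (f.1 * g.1).coeff m = 0
    rw [AddMonoidAlgebra.coeff_mul]
    refine Finset.sum_eq_zero fun k _ ↦ Finset.sum_eq_zero fun l _ ↦ ?_
    dsimp only
    split_ifs with h
    · by_cases hk : k = i
      · rw [hg l (by omega), mul_zero]
      · rw [hf k hk, zero_mul]
    · rfl
  decompose' := decomposition
  left_inv f := ext_coeff fun m ↦ by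
    rw [coeff_coeAddMonoidHom, decomposition_apply, component_coeff_self]
  right_inv x := by
    refine DFinsupp.ext fun n ↦ Subtype.ext ?_
    rw [decomposition_apply]
    conv_rhs => rw [← component_eq_self (x n).2]
    refine Subtype.ext ?_
    change AddMonoidAlgebra.single n _ = AddMonoidAlgebra.single n _
    rw [coeff_coeAddMonoidHom]

theorem component_mem_of_isHomogeneous {P : Ideal (extendedRees 𝔞)}
    (hP : P.IsHomogeneous (grading 𝔞)) {f : extendedRees 𝔞} (hf : f ∈ P) (n : ℤ) :
    component f n ∈ P := by
  rw [← decomposition_apply]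
  exact hP n hf

variable (𝔞) in
/-- The irrelevant ideal `𝔞 t · R[𝔞 t, t⁻¹]` of the extended Rees algebra. -/
noncomputable def irrelevant : Ideal (extendedRees 𝔞) :=
  Ideal.span {y | ∃ a ∈ 𝔞, (y : LaurentPolynomial R) = .single 1 a}

theorem tInv_mem_nonZeroDivisors : tInv 𝔞 ∈ nonZeroDivisors (extendedRees 𝔞) := by
  rw [mem_nonZeroDivisors_iff_right]
  intro z hz
  have h : z.1 * LaurentPolynomial.T (-1) = 0 := congrArg Subtype.val hz
  exact Subtype.ext ((LaurentPolynomial.isUnit_T (-1)).mul_left_eq_zero.mp h)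

theorem exists_mem_grading_one_notMem {P : Ideal (extendedRees 𝔞)} (h : ¬ irrelevant 𝔞 ≤ P) :
    ∃ κ ∈ grading 𝔞 1, κ ∉ P := by
  rw [irrelevant, Ideal.span_le, Set.not_subset] at h
  obtain ⟨y, ⟨a, -, hy⟩, hyP⟩ := h
  refine ⟨y, fun m hm ↦ ?_, hyP⟩
  rw [hy]
  exact Finsupp.single_eq_of_ne hm

theorem single_mem_irrelevant (e : ℕ) {r : R} (hr : r ∈ 𝔞 ^ (e + 1)) :
    ∃ h, (⟨.single ((e + 1 : ℕ) : ℤ) r, h⟩ : extendedRees 𝔞) ∈ irrelevant 𝔞 := by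
  rw [pow_succ'] at hr
  refine Submodule.mul_induction_on hr (fun a ha b hb ↦ ?_) fun x y hx hy ↦ ?_
  · have hb' : b ∈ 𝔞 ^ (e : ℤ).toNat := by simpa using hb
    have ha' : a ∈ 𝔞 ^ (1 : ℤ).toNat := by simpa using ha
    have hab : (.single ((e + 1 : ℕ) : ℤ) (a * b) : LaurentPolynomial R) =
        .single 1 a * .single (e : ℤ) b := by
      rw [AddMonoidAlgebra.single_mul_single, add_comm (1 : ℤ)]
      norm_cast
    have hmem := mul_mem (single_mem 𝔞 ha') (single_mem 𝔞 hb')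
    refine ⟨hab ▸ hmem, ?_⟩
    have h2 : (⟨.single 1 a, single_mem 𝔞 ha'⟩ * ⟨.single (e : ℤ) b, single_mem 𝔞 hb'⟩ :
        extendedRees 𝔞) ∈ irrelevant 𝔞 :=
      Ideal.mul_mem_right _ _ (Ideal.subset_span ⟨a, ha, rfl⟩)
    convert h2 using 1
    exact Subtype.ext hab
  · obtain ⟨hx, hx'⟩ := hx
    obtain ⟨hy, hy'⟩ := hy
    have hxy := AddMonoidAlgebra.single_add ((e + 1 : ℕ) : ℤ) x y
    refine ⟨hxy ▸ add_mem hx hy, ?_⟩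
    convert add_mem hx' hy' using 1
    exact Subtype.ext hxy

theorem mem_irrelevant_of_mem_grading {e : ℕ} (he : 1 ≤ e) {y : extendedRees 𝔞}
    (hy : y ∈ grading 𝔞 (e : ℤ)) : y ∈ irrelevant 𝔞 := by
  obtain ⟨e, rfl⟩ := Nat.exists_eq_add_of_le' he
  have h1 : y.1.coeff ((e + 1 : ℕ) : ℤ) ∈ 𝔞 ^ (e + 1) := by simpa using y.2 ((e + 1 : ℕ) : ℤ)
  obtain ⟨h, hmem⟩ := single_mem_irrelevant e h1
  rw [← component_eq_self hy]
  exact hmem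

theorem coe_algebraMap (r : R) :
    (algebraMap R (extendedRees 𝔞) r : LaurentPolynomial R) = .single 0 r := rfl

theorem le_comap_irrelevant : 𝔞 ≤ (irrelevant 𝔞).comap (algebraMap R (extendedRees 𝔞)) := by
  intro a ha
  have ha' : a ∈ 𝔞 ^ (1 : ℤ).toNat := by simpa using ha
  have h : algebraMap R (extendedRees 𝔞) a = ⟨.single 1 a, single_mem 𝔞 ha'⟩ * tInv 𝔞 := by
    refine Subtype.ext ?_
    change AddMonoidAlgebra.single 0 a =
      AddMonoidAlgebra.single 1 a * AddMonoidAlgebra.single (-1) 1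
    rw [AddMonoidAlgebra.single_mul_single]
    simp
  rw [Ideal.mem_comap, h]
  exact Ideal.mul_mem_right _ _ (Ideal.subset_span ⟨a, ha, rfl⟩)

variable (𝔞) in
/-- The ideal of elements of the extended Rees algebra with all coefficients in `q`. -/
noncomputable def coeffIdeal (q : Ideal R) : Ideal (extendedRees 𝔞) :=
  RingHom.ker ((AddMonoidAlgebra.mapRingHom ℤ (Ideal.Quotient.mk q)).comp
    (extendedRees 𝔞).val.toRingHom)

theorem mem_coeffIdeal {q : Ideal R} {f : extendedRees 𝔞} :
    f ∈ coeffIdeal 𝔞 q ↔ ∀ n, f.1.coeff n ∈ q := by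
  rw [coeffIdeal, RingHom.mem_ker]
  simp_rw [← Ideal.Quotient.eq_zero_iff_mem]
  constructor
  · intro h n
    exact congrArg (fun g : LaurentPolynomial (R ⧸ q) ↦ g.coeff n) h
  · exact fun h ↦ LaurentPolynomial.ext h

instance (q : Ideal R) [q.IsPrime] : (coeffIdeal 𝔞 q).IsPrime := by
  rw [coeffIdeal]
  exact RingHom.ker_isPrime _

theorem quotient_coeff_zero_mul {q : Ideal R} (hq : 𝔞 ≤ q) (f g : extendedRees 𝔞) :
    Ideal.Quotient.mk q ((f.1 * g.1).coeff 0) =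
      Ideal.Quotient.mk q (f.1.coeff 0) * Ideal.Quotient.mk q (g.1.coeff 0) := by
  classical
  have hpos : ∀ (f : extendedRees 𝔞) (n : ℤ), 0 < n → Ideal.Quotient.mk q (f.1.coeff n) = 0 :=
    fun f n hn ↦ Ideal.Quotient.eq_zero_iff_mem.mpr
      (hq (Ideal.pow_le_self (by omega) (f.2 n)))
  have hsum : ∀ f : extendedRees 𝔞, Ideal.Quotient.mk q (f.1.coeff 0) =
      ∑ i ∈ f.1.coeff.support, if i = 0 then Ideal.Quotient.mk q (f.1.coeff i) else 0 := by
    intro f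
    rw [Finset.sum_ite_eq']
    split_ifs with h
    · rfl
    · rw [Finsupp.notMem_support_iff.mp h, map_zero]
  rw [hsum f, hsum g, Finset.sum_mul_sum, AddMonoidAlgebra.coeff_mul, Finsupp.sum, map_sum]
  refine Finset.sum_congr rfl fun i _ ↦ ?_
  rw [Finsupp.sum, map_sum]
  refine Finset.sum_congr rfl fun j _ ↦ ?_
  rcases lt_trichotomy i 0 with hi | rfl | hi
  · rw [if_neg hi.ne, zero_mul]
    split_ifs with h
    · rw [map_mul, hpos g j (by omega), mul_zero]
    · exact map_zero _
  · simp only [zero_add, if_true]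
    split_ifs with h
    · exact map_mul _ _ _
    · rw [map_zero, mul_zero]
  · rw [if_neg hi.ne', zero_mul]
    split_ifs with h
    · rw [map_mul, hpos f i hi, zero_mul]
    · exact map_zero _

/-- Taking constant coefficients modulo `q ≥ 𝔞` is a ring homomorphism on the extended Rees
algebra. -/
noncomputable def coeffZeroHom {q : Ideal R} (hq : 𝔞 ≤ q) : extendedRees 𝔞 →+* R ⧸ q where
  toFun f := Ideal.Quotient.mk q (f.1.coeff 0)
  map_one' := by
    change Ideal.Quotient.mk q ((1 : LaurentPolynomial R).coeff 0) = 1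
    rw [← map_one LaurentPolynomial.C, LaurentPolynomial.C_apply, if_pos rfl, map_one]
  map_mul' f g := quotient_coeff_zero_mul hq f g
  map_zero' := map_zero _
  map_add' f g := map_add _ _ _

theorem mem_ker_coeffZeroHom {q : Ideal R} (hq : 𝔞 ≤ q) {f : extendedRees 𝔞} :
    f ∈ RingHom.ker (coeffZeroHom hq) ↔ f.1.coeff 0 ∈ q :=
  Ideal.Quotient.eq_zero_iff_mem

theorem coeff_zero_mem_of_isHomogeneous {P : Ideal (extendedRees 𝔞)}
    (hP : P.IsHomogeneous (grading 𝔞)) {f : extendedRees 𝔞} (hf : f ∈ P) :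
    f.1.coeff 0 ∈ P.comap (algebraMap R (extendedRees 𝔞)) :=
  component_mem_of_isHomogeneous hP hf 0

theorem coeff_mem_of_isHomogeneous {P : Ideal (extendedRees 𝔞)} [hPp : P.IsPrime]
    (hP : P.IsHomogeneous (grading 𝔞)) (hu : tInv 𝔞 ∉ P) {f : extendedRees 𝔞} (hf : f ∈ P)
    {n : ℕ} : f.1.coeff (-n) ∈ P.comap (algebraMap R (extendedRees 𝔞)) := by
  have h : component f (-n) =
      algebraMap R (extendedRees 𝔞) (f.1.coeff (-n)) * tInv 𝔞 ^ n := by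
    refine Subtype.ext ?_
    change AddMonoidAlgebra.single (-n : ℤ) _ =
      AddMonoidAlgebra.single 0 _ * AddMonoidAlgebra.single (-1) 1 ^ n
    rw [AddMonoidAlgebra.single_pow, AddMonoidAlgebra.single_mul_single]
    simp
  have hmem := component_mem_of_isHomogeneous hP hf (-n)
  rw [h] at hmem
  exact (hPp.mem_or_mem hmem).resolve_right fun h ↦ hu (hPp.mem_of_pow_mem _ h)

variable (𝔞) in
theorem eq_adjoin : extendedRees 𝔞 = Algebra.adjoin R
    ({x : LaurentPolynomial R | ∃ a ∈ 𝔞, .single 1 a = x} ∪ {.single (-1) 1}) := by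
  apply le_antisymm
  · set S := Algebra.adjoin R
      ({x : LaurentPolynomial R | ∃ a ∈ 𝔞, .single 1 a = x} ∪ {.single (-1) 1})
    have hpos : ∀ (n : ℕ) (r : R), r ∈ 𝔞 ^ n → (.single (n : ℤ) r : LaurentPolynomial R) ∈ S := by
      intro n
      induction n with
      | zero => exact fun r _ ↦ S.algebraMap_mem r
      | succ n ih =>
        intro r hr
        rw [pow_succ] at hr
        refine Submodule.mul_induction_on hr (fun b hb a ha ↦ ?_) fun x y hx hy ↦ ?_
        · rw [Nat.cast_add, Nat.cast_one, ← AddMonoidAlgebra.single_mul_single]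
          exact mul_mem (ih b hb) (Algebra.subset_adjoin (Or.inl ⟨a, ha, rfl⟩))
        · rw [AddMonoidAlgebra.single_add]
          exact add_mem hx hy
    have hneg : ∀ (n : ℕ) (r : R), (.single (-n : ℤ) r : LaurentPolynomial R) ∈ S := by
      intro n r
      have h : (.single (-n : ℤ) r : LaurentPolynomial R) =
          algebraMap R (LaurentPolynomial R) r *
            (AddMonoidAlgebra.single (-1) 1 : LaurentPolynomial R) ^ n := by
        change _ = AddMonoidAlgebra.single 0 r * _
        rw [AddMonoidAlgebra.single_pow, AddMonoidAlgebra.single_mul_single]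
        simp
      rw [h]
      refine mul_mem (S.algebraMap_mem r) (pow_mem ?_ n)
      exact Algebra.subset_adjoin (Or.inr rfl)
    intro f hf
    rw [← AddMonoidAlgebra.sum_coeff_single f]
    refine sum_mem fun n _ ↦ ?_
    obtain ⟨n, rfl | rfl⟩ := n.eq_nat_or_neg
    · exact hpos n _ (by simpa using hf n)
    · exact hneg n _
  · refine Algebra.adjoin_le ?_
    rintro _ (⟨a, ha, rfl⟩ | rfl)
    · exact single_mem 𝔞 (by simpa using ha)
    · exact (tInv 𝔞).2

theorem eq_adjoin_of_span_eq {s : Set R} (hs : Ideal.span s = 𝔞) :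
    extendedRees 𝔞 = Algebra.adjoin R
      (insert (.single (-1) 1) ((fun a ↦ .single 1 a) '' s : Set (LaurentPolynomial R))) := by
  refine le_antisymm ((eq_adjoin 𝔞).le.trans (Algebra.adjoin_le ?_)) (Algebra.adjoin_le ?_)
  · set S := Algebra.adjoin R
      (insert (.single (-1) 1) ((fun a ↦ .single 1 a) '' s : Set (LaurentPolynomial R)))
    rintro x (⟨a, ha, hx⟩ | hx)
    · rw [← hx]
      clear hx
      rw [← hs] at ha
      refine Submodule.span_induction (p := fun a _ ↦ (.single 1 a : LaurentPolynomial R) ∈ S)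
        (fun a ha ↦ ?_) ?_ (fun a b _ _ ha hb ↦ ?_) (fun r a _ ha ↦ ?_) ha
      · exact Algebra.subset_adjoin (Or.inr ⟨a, ha, rfl⟩)
      · rw [AddMonoidAlgebra.single_zero]
        exact zero_mem S
      · rw [AddMonoidAlgebra.single_add]
        exact add_mem ha hb
      · rw [← AddMonoidAlgebra.smul_single]
        exact Subalgebra.smul_mem _ ha r
    · exact Algebra.subset_adjoin (Or.inl hx)
  · rintro x (hx | ⟨a, ha, hx⟩)
    · exact hx ▸ (tInv 𝔞).2
    · rw [← hx]
      refine single_mem 𝔞 ?_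
      rw [Int.toNat_one, pow_one, ← hs]
      exact Ideal.subset_span ha

instance [IsNoetherianRing R] : IsNoetherianRing (extendedRees 𝔞) := by
  obtain ⟨s, hs⟩ := IsNoetherian.noetherian 𝔞
  rw [eq_adjoin_of_span_eq hs]
  exact isNoetherianRing_of_fg
    (Subalgebra.fg_def.mpr ⟨_, (s.finite_toSet.image _).insert _, rfl⟩)

theorem height_le [IsNoetherianRing R] (Q : Ideal (extendedRees 𝔞)) [Q.IsPrime] :
    Q.height ≤ (Q.comap (algebraMap R (extendedRees 𝔞))).height + 1 := by
  classical
  obtain ⟨s, hs⟩ := IsNoetherian.noetherian 𝔞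
  have h := eq_adjoin_of_span_eq hs
  rw [← Finset.coe_image] at h
  have hu : (.single (-1) 1 : LaurentPolynomial R) ∈ nonZeroDivisors (LaurentPolynomial R) :=
    (LaurentPolynomial.isUnit_T (-1)).mem_nonZeroDivisors
  have hx : ∀ x ∈ s.image fun a ↦ (.single 1 a : LaurentPolynomial R),
      ∃ r, .single (-1) 1 * x = algebraMap R (LaurentPolynomial R) r := by
    intro x hx
    obtain ⟨a, -, rfl⟩ := Finset.mem_image.mp hx
    refine ⟨a, ?_⟩
    change _ = AddMonoidAlgebra.single 0 a
    rw [AddMonoidAlgebra.single_mul_single]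
    simp
  have key : ∀ S : Subalgebra R (LaurentPolynomial R), S = Algebra.adjoin R (insert (.single (-1) 1)
      (s.image fun a ↦ (.single 1 a : LaurentPolynomial R) : Set (LaurentPolynomial R))) →
      ∀ (Q : Ideal S) [Q.IsPrime], Q.height ≤ (Q.comap (algebraMap R S)).height + 1 := by
    rintro _ rfl
    exact height_adjoin_insert_le hu _ hx
  exact key _ h Q

theorem exists_list_radical_eq [IsNoetherianRing R] [IsLocalRing R] {d : ℕ} (hd1 : 1 ≤ d)
    (hd : ringKrullDim R = d) (h𝔞 : 𝔞 ≠ ⊤) (hht : ∀ P ∈ minimalPrimes R, ¬ 𝔞 ≤ P) :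
    ∃ F : List (extendedRees 𝔞), F.length = d ∧
      ((IsLocalRing.maximalIdeal R).map (algebraMap R (extendedRees 𝔞)) ⊔ irrelevant 𝔞).radical =
        (Ideal.span {f | f ∈ F}).radical := by
  refine _root_.exists_list_radical_eq (grading 𝔞) hd1 hd 𝔞 h𝔞 (fun q hq h𝔞q ↦ ?_)
    tInv_mem_nonZeroDivisors (irrelevant 𝔞) (fun P _ ↦ exists_mem_grading_one_notMem)
    (fun e he y ↦ mem_irrelevant_of_mem_grading he) le_comap_irrelevant fun q hq h𝔞q ↦ ?_
  · rw [Order.one_le_iff_ne_zero, Ne, Ideal.height_eq_zero_iff]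
    exact fun h ↦ hht q h h𝔞q
  have hN : (RingHom.ker (coeffZeroHom h𝔞q)).IsPrime := RingHom.ker_isPrime _
  refine ⟨RingHom.ker (coeffZeroHom h𝔞q), coeffIdeal 𝔞 q, hN, inferInstance, ?_, ?_, ?_, ?_⟩
  · refine lt_of_le_of_ne (fun f hf ↦ (mem_ker_coeffZeroHom h𝔞q).mpr (mem_coeffIdeal.mp hf 0)) ?_
    intro h
    have h1 : tInv 𝔞 ∈ RingHom.ker (coeffZeroHom h𝔞q) := by
      rw [mem_ker_coeffZeroHom]
      change (LaurentPolynomial.T (-1) : LaurentPolynomial R).coeff 0 ∈ q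
      simp
    rw [← h, mem_coeffIdeal] at h1
    have h2 : (LaurentPolynomial.T (-1) : LaurentPolynomial R).coeff (-1) ∈ q := h1 (-1)
    rw [LaurentPolynomial.T_apply, if_pos rfl] at h2
    exact hq.ne_top ((Ideal.eq_top_iff_one q).mpr h2)
  · refine Ideal.span_le.mpr ?_
    rintro y ⟨a, ha, hy⟩
    refine mem_coeffIdeal.mpr fun n ↦ ?_
    rw [hy]
    classical
    rw [AddMonoidAlgebra.coeff_single, Finsupp.single_apply]
    split_ifs
    · exact h𝔞q ha
    · exact q.zero_mem
  · refine (height_le _).trans (add_le_add_left (Ideal.height_mono fun r hr ↦ ?_) 1)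
    have h := (mem_ker_coeffZeroHom h𝔞q).mp (Ideal.mem_comap.mp hr)
    rw [coe_algebraMap] at h
    simpa using h
  · intro P hPp hP hPq
    refine ⟨fun f hf ↦ (mem_ker_coeffZeroHom h𝔞q).mpr
      (hPq (coeff_zero_mem_of_isHomogeneous hP hf)), fun hu f hf ↦ mem_coeffIdeal.mpr fun n ↦ ?_⟩
    rcases lt_or_ge 0 n with hn | hn
    · exact h𝔞q (Ideal.pow_le_self (by omega) (f.2 n))
    · obtain ⟨n, rfl⟩ := Int.exists_eq_neg_ofNat hn
      exact hPq (coeff_mem_of_isHomogeneous hP hu hf)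

end extendedRees

end ExtendedRees

/-- Let `(R,𝔪)` be a Noetherian local ring of Krull dimension `d ≥ 2` and
`𝔞 ⊊ R` a proper ideal of positive height (i.e. contained in no minimal prime of `R`),
`T𝔞 = R[𝔞t,t⁻¹]` the extended Rees algebra and `𝔪_S·T𝔞` the ideal of `T𝔞` generated by the
`C x`, `x ∈ 𝔪`, and the `C a * T 1`, `a ∈ 𝔞`.  Then `H^{d+1}_{𝔪_S·T𝔞}(T𝔞) = 0`. -/
theorem extendedRees_localCohomology_top_vanishing
    {R : Type} [CommRing R] [IsNoetherianRing R] [IsLocalRing R]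
    (d : ℕ) (hd2 : 2 ≤ d) (hd : ringKrullDim R = d)
    (𝔞 : Ideal R) (h𝔞 : 𝔞 ≠ ⊤)
    (hht : ∀ P ∈ minimalPrimes R, ¬ 𝔞 ≤ P)
    (T𝔞 : Subalgebra R (LaurentPolynomial R))
    (hT𝔞 : T𝔞 = Algebra.adjoin R
      ({x : LaurentPolynomial R | ∃ a ∈ 𝔞, C a * T 1 = x} ∪ {T (-1)}))
    (I : Ideal T𝔞)
    (hI : I = Ideal.span
      ({y : T𝔞 | ∃ x ∈ maximalIdeal R, (y : LaurentPolynomial R) = C x} ∪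
        {y : T𝔞 | ∃ a ∈ 𝔞, (y : LaurentPolynomial R) = C a * T 1})) :
    Subsingleton ((localCohomology I (d + 1)).obj (ModuleCat.of T𝔞 T𝔞)) := by
  have h1 : ∀ a : R, (.single 1 a : LaurentPolynomial R) = C a * T 1 := fun a ↦
    LaurentPolynomial.single_eq_C_mul_T a 1
  have hT : T𝔞 = extendedRees 𝔞 := by
    rw [hT𝔞, extendedRees.eq_adjoin]
    simp_rw [h1]
    rfl
  clear hT𝔞
  subst hT
  have hI' : I = (maximalIdeal R).map (algebraMap R (extendedRees 𝔞)) ⊔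
      extendedRees.irrelevant 𝔞 := by
    rw [hI, Ideal.span_union, extendedRees.irrelevant, Ideal.map]
    simp_rw [h1]
    congr 2
    ext y
    constructor
    · rintro ⟨x, hx, hy⟩
      exact ⟨x, hx, (Subtype.ext hy).symm⟩
    · rintro ⟨x, hx, rfl⟩
      exact ⟨x, hx, rfl⟩
  obtain ⟨F, rfl, hF⟩ := extendedRees.exists_list_radical_eq (by omega) hd h𝔞 hht
  exact subsingleton_localCohomology_of_radical_eq F (hI' ▸ hF) _
end
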